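/- arXiv:1711.09310 — 2 statements merged into one kernel-verified Lean document; each statement's English description precedes it below -/
import Mathlib

section
/- For every positive integer k there exists a real number α_k with π/2 < α_k < π such that the following holds: for every p with 1 ≤ p ≤ k and all distinct reals t₁ < t₂ < … < t_p with t_p − t₁ < α_k (i.e., p distinct points of an open arc of length α_k), the set conv{U_k(t₁), …, U_k(t_p)} is a face of the convex body B_k = conv{U_k(t) : t ∈ ℝ} ⊂ ℝ^{2k}, where U_k(t) = (cos t, sin t, cos 3t, sin 3t, …, cos((2k−1)t), sin((2k−1)t)). -/
open Set

/-- A (nonempty, proper) exposed face of a convex body `K`. -/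
def IsProperFace {E : Type*} [AddCommGroup E] [Module ℝ E] [TopologicalSpace E]
    (K F : Set E) : Prop :=
  F.Nonempty ∧ F ≠ K ∧ IsExposed ℝ K F

/-- The symmetric moment curve
`U_k(t) = (cos t, sin t, cos 3t, sin 3t, …, cos((2k−1)t), sin((2k−1)t)) ∈ ℝ^{2k}`:
coordinate `2i` is `cos((2i+1)t)` and coordinate `2i+1` is `sin((2i+1)t)`. -/
noncomputable def Uk (k : ℕ) (t : ℝ) : Fin (2 * k) → ℝ := fun j =>
  if j.val % 2 = 0 then Real.cos ((j.val + 1) * t) else Real.sin (j.val * t)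

/-- The span of `sin` and `cos`. Its power `trigLinear ^ n` consists of the homogeneous forms of
degree `n` in `sin` and `cos`. -/
noncomputable def trigLinear : Submodule ℝ (ℝ → ℝ) := Submodule.span ℝ {Real.sin, Real.cos}

lemma lin_mem_trigLinear (a b : ℝ) : (fun t => a * Real.sin t + b * Real.cos t) ∈ trigLinear :=
  Submodule.mem_span_pair.2 ⟨a, b, by ext t; simp⟩

lemma mem_trigLinear {l : ℝ → ℝ} (hl : l ∈ trigLinear) :
    ∃ a b : ℝ, l = fun t => a * Real.sin t + b * Real.cos t := by
  obtain ⟨a, b, h⟩ := Submodule.mem_span_pair.1 hl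
  exact ⟨a, b, by rw [← h]; ext t; simp⟩

lemma sin_sub_mem (a : ℝ) : (fun t => Real.sin (t - a)) ∈ trigLinear := by
  convert lin_mem_trigLinear (Real.cos a) (-Real.sin a) using 2 with t
  rw [Real.sin_sub]; ring

lemma cos_sub_mem (a : ℝ) : (fun t => Real.cos (t - a)) ∈ trigLinear := by
  convert lin_mem_trigLinear (Real.sin a) (Real.cos a) using 2 with t
  rw [Real.cos_sub]; ring

lemma mem_trigLinear_sub {l : ℝ → ℝ} (hl : l ∈ trigLinear) (c : ℝ) :
    ∃ a b : ℝ, l = fun t => a * Real.sin (t - c) + b * Real.cos (t - c) := by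
  obtain ⟨a, b, rfl⟩ := mem_trigLinear hl
  refine ⟨a * Real.cos c - b * Real.sin c, a * Real.sin c + b * Real.cos c, ?_⟩
  ext t
  have h1 : Real.sin t = Real.sin (t - c + c) := by ring_nf
  have h2 : Real.cos t = Real.cos (t - c + c) := by ring_nf
  rw [h1, h2, Real.sin_add, Real.cos_add]; ring

lemma form_induction {C : ℕ → (ℝ → ℝ) → Prop} (const : ∀ r : ℝ, C 0 (fun _ => r))
    (add : ∀ n f g, C n f → C n g → C n (f + g))
    (mul : ∀ n, ∀ l ∈ trigLinear, ∀ g ∈ trigLinear ^ n, C n g → C (n + 1) (l * g))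
    {n : ℕ} {f : ℝ → ℝ} (hf : f ∈ trigLinear ^ n) : C n f :=
  Submodule.pow_induction_on_left' (C := fun n f _ => C n f) trigLinear const
    (fun f g n _ _ => add n f g) (fun l hl n g hg => mul n l hl g hg) hf

lemma form_analytic {n : ℕ} {f : ℝ → ℝ} (hf : f ∈ trigLinear ^ n) (x : ℝ) : AnalyticAt ℝ f x := by
  refine form_induction (C := fun _ f => AnalyticAt ℝ f x) (fun r => analyticAt_const)
    (fun n f g => AnalyticAt.add) (fun n l hl g _ hg => ?_) hf
  obtain ⟨a, b, rfl⟩ := mem_trigLinear hl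
  exact AnalyticAt.mul (by fun_prop) hg

lemma form_antiperiodic {n : ℕ} {f : ℝ → ℝ} (hf : f ∈ trigLinear ^ n) (t : ℝ) :
    f (t + Real.pi) = (-1) ^ n * f t := by
  refine form_induction (C := fun n f => f (t + Real.pi) = (-1) ^ n * f t) (by simp)
    (fun n f g h1 h2 => ?_) (fun n l hl g _ hg => ?_) hf
  · simp only [Pi.add_apply, h1, h2]; ring
  · obtain ⟨a, b, rfl⟩ := mem_trigLinear hl
    simp only [Pi.mul_apply, hg, Real.sin_add_pi, Real.cos_add_pi]; ring

lemma form_deriv {n : ℕ} {f : ℝ → ℝ} (hf : f ∈ trigLinear ^ n) :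
    deriv f ∈ trigLinear ^ n := by
  suffices h : Differentiable ℝ f ∧ deriv f ∈ trigLinear ^ n from h.2
  refine form_induction (C := fun n f => Differentiable ℝ f ∧ deriv f ∈ trigLinear ^ n)
    (fun r => ⟨by fun_prop, ?_⟩) (fun n f g h1 h2 => ⟨h1.1.add h2.1, ?_⟩)
    (fun n l hl g hg0 hg => ?_) hf
  · have : deriv (fun _ : ℝ => r) = 0 := by ext; simp
    rw [this]; exact zero_mem _
  · have : deriv (f + g) = deriv f + deriv g := by
      ext x; exact deriv_add (h1.1 x) (h2.1 x)
    rw [this]; exact add_mem h1.2 h2.2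
  · obtain ⟨a, b, rfl⟩ := mem_trigLinear hl
    refine ⟨Differentiable.mul (by fun_prop) hg.1, ?_⟩
    have : deriv ((fun t => a * Real.sin t + b * Real.cos t) * g) =
        (fun t => (-b) * Real.sin t + a * Real.cos t) * g +
        (fun t => a * Real.sin t + b * Real.cos t) * deriv g := by
      ext x
      have h : HasDerivAt (fun t => a * Real.sin t + b * Real.cos t)
          ((-b) * Real.sin x + a * Real.cos x) x := by
        exact (((Real.hasDerivAt_sin x).const_mul a).add
          ((Real.hasDerivAt_cos x).const_mul b)).congr_deriv (by ring)
      exact (h.mul (hg.1 x).hasDerivAt).deriv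
    rw [this, pow_succ']
    exact add_mem (Submodule.mul_mem_mul (lin_mem_trigLinear _ _) hg0)
      (Submodule.mul_mem_mul hl hg.2)

lemma form_decomp {n : ℕ} {f : ℝ → ℝ} (hf : f ∈ trigLinear ^ (n + 1)) (a : ℝ) :
    ∃ c : ℝ, ∃ E ∈ trigLinear ^ n,
      f = (fun t => Real.sin (t - a)) * E + fun t => c * Real.cos (t - a) ^ (n + 1) := by
  have main : ∀ {m : ℕ} {f : ℝ → ℝ}, f ∈ trigLinear ^ m → ∀ n, m = n + 1 →
      ∃ c : ℝ, ∃ E ∈ trigLinear ^ n,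
      f = (fun t => Real.sin (t - a)) * E + fun t => c * Real.cos (t - a) ^ (n + 1) := by
    intro m f hf
    refine form_induction (C := fun m f => ∀ n, m = n + 1 →
      ∃ c : ℝ, ∃ E ∈ trigLinear ^ n,
      f = (fun t => Real.sin (t - a)) * E + fun t => c * Real.cos (t - a) ^ (n + 1))
      (by simp) (fun m f g hf hg n hn => ?_) (fun m l hl g hg0 hg n hn => ?_) hf
    · obtain ⟨c, E, hE, rfl⟩ := hf n hn
      obtain ⟨c', E', hE', rfl⟩ := hg n hn
      exact ⟨c + c', E + E', add_mem hE hE', by ext t; simp; ring⟩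
    · obtain rfl : m = n := by omega
      obtain ⟨α, β, rfl⟩ := mem_trigLinear_sub hl a
      rcases m with _ | m
      · rw [pow_zero, Submodule.mem_one] at hg0
        obtain ⟨r, rfl⟩ := hg0
        refine ⟨β * r, fun _ => α * r, ?_, ?_⟩
        · rw [pow_zero, Submodule.mem_one]; exact ⟨α * r, rfl⟩
        · ext t; simp; ring
      · obtain ⟨c, E, hE, rfl⟩ := hg m rfl
        refine ⟨β * c, (fun t => α * Real.sin (t - a) + β * Real.cos (t - a)) * E +
          (c * α) • (fun t => Real.cos (t - a)) ^ (m + 1), add_mem ?_ (Submodule.smul_mem _ _ ?_), ?_⟩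
        · rw [pow_succ']; exact Submodule.mul_mem_mul hl hE
        · exact Submodule.pow_mem_pow _ (cos_sub_mem a) _
        · ext t; simp; ring
  exact main hf n rfl

lemma form_factor {n : ℕ} {f : ℝ → ℝ} (hf : f ∈ trigLinear ^ (n + 1)) {a : ℝ} (ha : f a = 0) :
    ∃ E ∈ trigLinear ^ n, f = (fun t => Real.sin (t - a)) * E := by
  obtain ⟨c, E, hE, rfl⟩ := form_decomp hf a
  have hc : c = 0 := by simpa using ha
  exact ⟨E, hE, by ext t; simp [hc]⟩

lemma sin_sub_ne_zero {x y : ℝ} (hxy : x ≠ y) (h : |x - y| < Real.pi) : Real.sin (x - y) ≠ 0 := by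
  rw [Ne, Real.sin_eq_zero_iff_of_lt_of_lt (abs_lt.1 h).1 (abs_lt.1 h).2]
  exact sub_ne_zero.2 hxy

lemma order_sin_sub_self (a : ℝ) : analyticOrderAt (fun t => Real.sin (t - a)) a = 1 := by
  apply AnalyticAt.analyticOrderAt_eq_one_of_zero_deriv_ne_zero (by fun_prop) (by simp)
  have h : HasDerivAt (fun t => Real.sin (t - a)) (Real.cos (a - a) * 1) a :=
    ((hasDerivAt_id a).sub_const a).sin
  rw [h.deriv]; simp

lemma order_sin_sub_of_ne {a x : ℝ} (h : Real.sin (x - a) ≠ 0) :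
    analyticOrderAt (fun t => Real.sin (t - a)) x = 0 :=
  analyticOrderAt_eq_zero.2 (Or.inr h)

/-- A nonzero form of degree `n` has at most `n` zeros, counted with multiplicity, in an interval
of length less than `π`. -/
lemma form_sum_order_le {n : ℕ} {f : ℝ → ℝ} (hf : f ∈ trigLinear ^ n) (h0 : f ≠ 0)
    (Z : Finset ℝ) (hZ : ∀ x ∈ Z, ∀ y ∈ Z, |x - y| < Real.pi) :
    ∑ z ∈ Z, analyticOrderAt f z ≤ n := by
  induction n generalizing f with
  | zero =>
    rw [pow_zero, Submodule.mem_one] at hf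
    obtain ⟨r, rfl⟩ := hf
    have hr : r ≠ 0 := by rintro rfl; exact h0 (by simp)
    refine (Finset.sum_eq_zero fun z _ => ?_).le
    exact analyticOrderAt_eq_zero.2 (Or.inr hr)
  | succ n ih =>
    by_cases hz : ∃ z ∈ Z, f z = 0
    · obtain ⟨a, haZ, ha⟩ := hz
      obtain ⟨E, hE, rfl⟩ := form_factor hf ha
      have hE0 : E ≠ 0 := by rintro rfl; exact h0 (by simp)
      have : ∀ z ∈ Z, analyticOrderAt ((fun t => Real.sin (t - a)) * E) z =
          (if z = a then 1 else 0) + analyticOrderAt E z := by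
        intro z hz
        rw [analyticOrderAt_mul (by fun_prop) (form_analytic hE z)]
        split_ifs with h
        · rw [h, order_sin_sub_self]
        · rw [order_sin_sub_of_ne (sin_sub_ne_zero h (hZ z hz a haZ))]
      rw [Finset.sum_congr rfl this, Finset.sum_add_distrib, Finset.sum_ite_eq' Z a, if_pos haZ,
        add_comm, Nat.cast_add, Nat.cast_one]
      gcongr
      exact ih hE hE0
    · push Not at hz
      rw [Finset.sum_eq_zero fun z hzZ => analyticOrderAt_eq_zero.2 (Or.inr (hz z hzZ))]
      exact zero_le

lemma analyticAt_dslope {f : ℝ → ℝ} {a x : ℝ} (ha : AnalyticAt ℝ f a) (hx : AnalyticAt ℝ f x) :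
    AnalyticAt ℝ (dslope f a) x := by
  rcases eq_or_ne x a with rfl | h
  · obtain ⟨p, hp⟩ := ha
    exact hp.has_fpower_series_dslope_fslope.analyticAt
  · refine AnalyticAt.congr ?_ (dslope_eventuallyEq_slope_of_ne f h).symm
    have : slope f a = fun y => (y - a)⁻¹ * (f y - f a) := by
      ext y; simp [slope_def_field, div_eq_inv_mul]
    rw [this]
    exact ((by fun_prop : AnalyticAt ℝ (fun y => y - a) x).inv (sub_ne_zero.2 h)).mul
      (hx.sub analyticAt_const)

/-- A zero of an analytic function can be split off as a factor `sin (t - a)`. -/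
lemma exists_sin_factor {f : ℝ → ℝ} {J : Set ℝ} {a : ℝ} (haJ : a ∈ J)
    (hJ : ∀ t ∈ J, |t - a| < Real.pi) (hf : AnalyticOnNhd ℝ f J) (ha : f a = 0) :
    ∃ q : ℝ → ℝ, AnalyticOnNhd ℝ q J ∧ ∀ t ∈ J, f t = Real.sin (t - a) * q t := by
  set S : ℝ → ℝ := fun t => Real.sin (t - a) with hS
  have hSa : ∀ x, AnalyticAt ℝ S x := fun x => by fun_prop
  have hd : ∀ t, (t - a) * dslope S a t = S t := fun t => by
    simpa [hS] using sub_smul_dslope S a t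
  have hf' : ∀ t, (t - a) * dslope f a t = f t := fun t => by
    simpa [ha] using sub_smul_dslope f a t
  have hne : ∀ t ∈ J, dslope S a t ≠ 0 := by
    intro t ht
    rcases eq_or_ne t a with rfl | h
    · have h : HasDerivAt S (Real.cos (t - t) * 1) t := ((hasDerivAt_id t).sub_const t).sin
      rw [dslope_same, h.deriv]; simp
    · intro h0
      have := hd t
      rw [h0, mul_zero] at this
      exact sin_sub_ne_zero h (hJ t ht) this.symm
  refine ⟨fun t => dslope f a t / dslope S a t, fun t ht =>
    (analyticAt_dslope (hf a haJ) (hf t ht)).div (analyticAt_dslope (hSa a) (hSa t)) (hne t ht),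
    fun t ht => ?_⟩
  have := hne t ht
  change f t = S t * _
  rw [← hf' t, ← hd t]
  field_simp

/-- If `g` is a form of odd degree `n`, then `1 - g` has at most `n + 1` zeros, counted with
multiplicity, in an interval of length less than `π`. -/
lemma sum_order_one_sub_le {n : ℕ} (hn : Odd n) {g : ℝ → ℝ} (hg : g ∈ trigLinear ^ n)
    (Z : Finset ℝ) (hZ : ∀ x ∈ Z, ∀ y ∈ Z, |x - y| < Real.pi) :
    ∑ z ∈ Z, analyticOrderAt (fun t => 1 - g t) z ≤ n + 1 := by
  classical
  set f : ℝ → ℝ := fun t => 1 - g t with hf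
  have hfa : ∀ x, AnalyticAt ℝ f x := fun x => analyticAt_const.sub (form_analytic hg x)
  have hfd : Differentiable ℝ f := fun x => (hfa x).differentiableAt
  have hd : deriv f = (-1 : ℝ) • deriv g := by
    ext x
    simp [hf]
  have hdF : deriv f ∈ trigLinear ^ n := by
    rw [hd]; exact Submodule.smul_mem _ _ (form_deriv hg)
  wlog hz : ∀ z ∈ Z, f z = 0 generalizing Z
  · have := this (Z.filter (f · = 0))
      (fun x hx y hy => hZ x (Finset.filter_subset _ _ hx) y (Finset.filter_subset _ _ hy))
      (fun z hz => (Finset.mem_filter.1 hz).2)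
    rw [Finset.sum_filter_of_ne] at this
    · exact this
    · intro x _ hx
      exact apply_eq_zero_of_analyticOrderAt_ne_zero hx
  rcases Z.eq_empty_or_nonempty with rfl | ⟨z₀, hz₀⟩
  · simp
  have hd0 : deriv f ≠ 0 := by
    intro h
    have hc := is_const_of_deriv_eq_zero hfd (fun x => congrFun h x)
    have h1 := hc (z₀ + Real.pi) z₀
    have h2 := form_antiperiodic hg z₀
    have h3 := hz z₀ hz₀
    rw [hn.neg_one_pow] at h2
    simp only [hf] at h1 h3
    linarith
  have hrolle : ∀ x y, ∃ c, x ∈ Z → y ∈ Z → x < y → (x < c ∧ c < y) ∧ deriv f c = 0 := by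
    intro x y
    by_cases h : x ∈ Z ∧ y ∈ Z ∧ x < y
    · obtain ⟨c, hc, hc'⟩ := exists_deriv_eq_zero h.2.2 hfd.continuous.continuousOn
        ((hz x h.1).trans (hz y h.2.1).symm)
      exact ⟨c, fun _ _ _ => ⟨hc, hc'⟩⟩
    · exact ⟨0, fun h1 h2 h3 => absurd ⟨h1, h2, h3⟩ h⟩
  choose c hc using hrolle
  set T : Finset ℝ := ((Z ×ˢ Z).filter fun p => p.1 < p.2).image fun p => c p.1 p.2 with hT
  have hTmem : ∀ x ∈ T, deriv f x = 0 ∧ ∃ a ∈ Z, ∃ b ∈ Z, a ≤ x ∧ x ≤ b := by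
    intro x hx
    simp only [hT, Finset.mem_image, Finset.mem_filter, Finset.mem_product, Prod.exists] at hx
    obtain ⟨a, b, ⟨⟨ha, hb⟩, hab⟩, rfl⟩ := hx
    obtain ⟨⟨h1, h2⟩, h3⟩ := hc a b ha hb hab
    exact ⟨h3, a, ha, b, hb, h1.le, h2.le⟩
  have hcard : Z.card ≤ (T \ Z).card + 1 := by
    refine Finset.card_le_sdiff_of_interleaved fun x hx y hy hxy _ => ?_
    refine ⟨c x y, ?_, (hc x y hx hy hxy).1⟩
    exact Finset.mem_image.2 ⟨(x, y), by simp [hx, hy, hxy], rfl⟩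
  have hU : ∀ x ∈ Z ∪ T \ Z, ∃ a ∈ Z, ∃ b ∈ Z, a ≤ x ∧ x ≤ b := by
    intro x hx
    rcases Finset.mem_union.1 hx with h | h
    · exact ⟨x, h, x, h, le_rfl, le_rfl⟩
    · exact (hTmem x (Finset.mem_sdiff.1 h).1).2
  have hbound := form_sum_order_le hdF hd0 (Z ∪ T \ Z) (by
    intro x hx y hy
    obtain ⟨a, ha, b, hb, h1, h2⟩ := hU x hx
    obtain ⟨a', ha', b', hb', h1', h2'⟩ := hU y hy
    have e1 := abs_lt.1 (hZ a ha b' hb')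
    have e2 := abs_lt.1 (hZ b hb a' ha')
    rw [abs_lt]; constructor <;> linarith)
  rw [Finset.sum_union Finset.disjoint_sdiff] at hbound
  have hone : ((T \ Z).card : ℕ∞) ≤ ∑ z ∈ T \ Z, analyticOrderAt (deriv f) z := by
    rw [Finset.card_eq_sum_ones, Nat.cast_sum]
    refine Finset.sum_le_sum fun z hz' => ?_
    rw [Nat.cast_one, Order.one_le_iff_ne_zero, analyticOrderAt_ne_zero]
    exact ⟨(hfa z).deriv, (hTmem z (Finset.mem_sdiff.1 hz').1).1⟩
  have hord : ∀ z ∈ Z, analyticOrderAt f z = analyticOrderAt (deriv f) z + 1 := by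
    intro z hz'
    rw [(hfa z).analyticOrderAt_deriv_add_one]
    simp [hz z hz']
  rw [Finset.sum_congr rfl hord, Finset.sum_add_distrib, Finset.sum_const, nsmul_eq_mul, mul_one]
  calc _ ≤ ∑ z ∈ Z, analyticOrderAt (deriv f) z + ((T \ Z).card + 1) := by
        gcongr; exact_mod_cast hcard
    _ ≤ ∑ z ∈ Z, analyticOrderAt (deriv f) z +
          (∑ z ∈ T \ Z, analyticOrderAt (deriv f) z + 1) := by gcongr
    _ ≤ n + 1 := by rw [← add_assoc]; gcongr

/-- The product of the functions `sin (t - a)` over the nodes `a ∈ S`. -/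
noncomputable def sinProd (S : Multiset ℝ) (t : ℝ) : ℝ := (S.map fun a => Real.sin (t - a)).prod

@[simp] lemma sinProd_zero (t : ℝ) : sinProd 0 t = 1 := by simp [sinProd]

@[simp] lemma sinProd_cons (a : ℝ) (S : Multiset ℝ) (t : ℝ) :
    sinProd (a ::ₘ S) t = Real.sin (t - a) * sinProd S t := by simp [sinProd]

@[simp] lemma sinProd_add (S T : Multiset ℝ) (t : ℝ) :
    sinProd (S + T) t = sinProd S t * sinProd T t := by simp [sinProd]

lemma sinProd_mem (S : Multiset ℝ) : sinProd S ∈ trigLinear ^ S.card := by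
  induction S using Multiset.induction_on with
  | empty =>
    rw [Multiset.card_zero, pow_zero, Submodule.mem_one]
    exact ⟨1, by ext t; simp⟩
  | cons a S ih =>
    rw [Multiset.card_cons, pow_succ',
      show sinProd (a ::ₘ S) = (fun t => Real.sin (t - a)) * sinProd S by ext t; simp]
    exact Submodule.mul_mem_mul (sin_sub_mem a) ih

lemma sinProd_analytic (S : Multiset ℝ) (x : ℝ) : AnalyticAt ℝ (sinProd S) x :=
  form_analytic (sinProd_mem S) x

lemma sinProd_ne_zero {S : Multiset ℝ} {t : ℝ} (hS : ∀ a ∈ S, |t - a| < Real.pi) (ht : t ∉ S) :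
    sinProd S t ≠ 0 := by
  rw [sinProd, Ne, Multiset.prod_eq_zero_iff, Multiset.mem_map]
  rintro ⟨a, ha, h⟩
  exact sin_sub_ne_zero (by rintro rfl; exact ht ha) (hS a ha) h

lemma sinProd_eq_zero {S : Multiset ℝ} {t : ℝ} (ht : t ∈ S) : sinProd S t = 0 := by
  rw [sinProd, Multiset.prod_eq_zero_iff, Multiset.mem_map]
  exact ⟨t, ht, by simp⟩

open Classical in
lemma count_le_order_sinProd (S : Multiset ℝ) (a : ℝ) :
    (S.count a : ℕ∞) ≤ analyticOrderAt (sinProd S) a := by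
  induction S using Multiset.induction_on with
  | empty => simp
  | cons b S ih =>
    rw [show sinProd (b ::ₘ S) = (fun t => Real.sin (t - b)) * sinProd S by ext t; simp,
      analyticOrderAt_mul (by fun_prop) (sinProd_analytic S a), Multiset.count_cons, add_comm]
    push_cast
    refine add_le_add ?_ ih
    split_ifs with h
    · rw [h, order_sin_sub_self]
    · simp

/-- The points at distance less than `π` from every point of `[A, B]`. -/
def nearArc (A B : ℝ) : Set ℝ := Ioo (B - Real.pi) (A + Real.pi)

lemma abs_sub_lt_pi {A B t a : ℝ} (ht : t ∈ nearArc A B) (ha : a ∈ Icc A B) :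
    |t - a| < Real.pi := by
  rw [abs_lt]
  have h1 := ht.1
  have h2 := ht.2
  constructor <;> linarith [ha.1, ha.2]

lemma mem_nearArc {A B a : ℝ} (hAB : B - A < Real.pi) (ha : a ∈ Icc A B) : a ∈ nearArc A B :=
  ⟨by linarith [ha.1, ha.2], by linarith [ha.1, ha.2]⟩

/-- `1 - g` vanishes on the multiset `S ⊆ [A, B]`, with cofactor `q`. -/
structure Vanishes (n : ℕ) (A B : ℝ) (S : Multiset ℝ) (g q : ℝ → ℝ) : Prop where
  mem : g ∈ trigLinear ^ n
  nodes : ∀ a ∈ S, a ∈ Icc A B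
  analytic : AnalyticOnNhd ℝ q (nearArc A B)
  eq : ∀ t ∈ nearArc A B, 1 - g t = sinProd S t * q t

lemma exists_vanishes {A B : ℝ} (hAB : B - A < Real.pi) (n : ℕ) (S : Multiset ℝ)
    (hS : ∀ a ∈ S, a ∈ Icc A B) (hn : S.card ≤ n + 1) : ∃ g q, Vanishes n A B S g q := by
  induction S using Multiset.induction_on with
  | empty => exact ⟨0, fun _ => 1, zero_mem _, by simp, fun _ _ => analyticAt_const, by simp⟩
  | cons a S ih =>
    rw [Multiset.card_cons] at hn
    have ha := hS a (Multiset.mem_cons_self a S)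
    have haJ := mem_nearArc hAB ha
    obtain ⟨g, q, h⟩ := ih (fun b hb => hS b (Multiset.mem_cons_of_mem hb)) (by omega)
    set e : ℝ → ℝ := fun t => Real.cos (t - a) ^ (n - S.card) with he
    have hemem : e ∈ trigLinear ^ (n - S.card) := Submodule.pow_mem_pow _ (cos_sub_mem a) _
    obtain ⟨q', hq', heq⟩ := exists_sin_factor (f := fun t => q t - q a * e t) haJ
      (fun t ht => abs_sub_lt_pi ht ha)
      (fun t ht => (h.analytic t ht).sub (analyticAt_const.mul (form_analytic hemem t)))
      (by simp [he])
    refine ⟨g + q a • (sinProd S * e), q', add_mem h.mem (Submodule.smul_mem _ _ ?_), hS, hq', ?_⟩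
    · have := Submodule.mul_mem_mul (sinProd_mem S) hemem
      rwa [← pow_add, show S.card + (n - S.card) = n by omega] at this
    · intro t ht
      have h1 := h.eq t ht
      have h2 := heq t ht
      simp only [Pi.add_apply, Pi.smul_apply, Pi.mul_apply, smul_eq_mul, sinProd_cons]
      linear_combination h1 + sinProd S t * h2

/-- Dividing a form by a product of sines gives a form. -/
lemma form_div {A B : ℝ} (hAB : B - A < Real.pi) {m j : ℕ} {D r : ℝ → ℝ} {S : Multiset ℝ}
    (hS : ∀ a ∈ S, a ∈ Icc A B) (hm : m = S.card + j) (hD : D ∈ trigLinear ^ m)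
    (hr : ∀ t ∈ nearArc A B, ContinuousAt r t) (h : ∀ t ∈ nearArc A B, D t = sinProd S t * r t) :
    ∃ E ∈ trigLinear ^ j, ∀ t ∈ nearArc A B, E t = r t := by
  induction S using Multiset.induction_on generalizing m D with
  | empty =>
    obtain rfl : m = j := by simpa using hm
    exact ⟨D, hD, by simpa using h⟩
  | cons a S ih =>
    have ha := hS a (Multiset.mem_cons_self a S)
    have haJ := mem_nearArc hAB ha
    rw [Multiset.card_cons] at hm
    obtain rfl : m = (S.card + j) + 1 := by omega
    obtain ⟨E, hE, rfl⟩ := form_factor hD (a := a) (by simpa using h a haJ)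
    refine ih (fun b hb => hS b (Multiset.mem_cons_of_mem hb)) rfl hE fun t ht => ?_
    have key : ∀ t ∈ nearArc A B, t ≠ a → E t = sinProd S t * r t := by
      intro t ht hta
      have := h t ht
      simp only [Pi.mul_apply, sinProd_cons, mul_assoc] at this
      exact mul_left_cancel₀ (sin_sub_ne_zero hta (abs_sub_lt_pi ht ha)) this
    rcases eq_or_ne t a with rfl | hta
    · have c1 : Filter.Tendsto E (nhdsWithin t {t}ᶜ) (nhds (E t)) :=
        (form_analytic hE t).continuousAt.continuousWithinAt
      have c2 : Filter.Tendsto (fun x => sinProd S x * r x) (nhdsWithin t {t}ᶜ)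
          (nhds (sinProd S t * r t)) :=
        ((sinProd_analytic S t).continuousAt.mul (hr t ht)).continuousWithinAt
      refine tendsto_nhds_unique (c1.congr' ?_) c2
      filter_upwards [self_mem_nhdsWithin, nhdsWithin_le_nhds (isOpen_Ioo.mem_nhds ht)] with x h1 h2
      exact key x h2 h1
    · exact key t ht hta

open Classical in
/-- The cofactor of a function `1 - g` vanishing on `n + 1` nodes has no zeros. -/
lemma Vanishes.cofactor_ne_zero {n : ℕ} (hn : Odd n) {A B : ℝ} (hAB : B - A < Real.pi)
    {S : Multiset ℝ} {g q : ℝ → ℝ} (h : Vanishes n A B S g q) (hS : S.card = n + 1) {t : ℝ}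
    (ht : t ∈ nearArc A B) : q t ≠ 0 := by
  intro h0
  obtain ⟨q', hq', hqq⟩ := exists_sin_factor (f := q) (a := t) (J := nearArc A B ∩ Ioo (t - Real.pi)
    (t + Real.pi)) ⟨ht, by linarith [Real.pi_pos], by linarith [Real.pi_pos]⟩
    (fun x hx => abs_lt.2 ⟨by linarith [hx.2.1], by linarith [hx.2.2]⟩)
    (fun x hx => h.analytic x hx.1) h0
  have hnear : ∀ x ∈ insert t S.toFinset, x ∈ nearArc A B ∩ Ioo (t - Real.pi) (t + Real.pi) := by
    intro x hx
    rcases Finset.mem_insert.1 hx with rfl | hx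
    · exact ⟨ht, by linarith [Real.pi_pos], by linarith [Real.pi_pos]⟩
    · have hx := h.nodes x (Multiset.mem_toFinset.1 hx)
      have := abs_lt.1 (abs_sub_lt_pi ht hx)
      exact ⟨mem_nearArc hAB hx, by linarith, by linarith⟩
  have hbound := sum_order_one_sub_le hn h.mem (insert t S.toFinset) (by
    intro x hx y hy
    rcases Finset.mem_insert.1 hx with hx | hx <;> rcases Finset.mem_insert.1 hy with hy | hy
    · rw [hx, hy]; simpa using Real.pi_pos
    · rw [hx]
      exact abs_sub_lt_pi ht (h.nodes y (Multiset.mem_toFinset.1 hy))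
    · rw [hy, abs_sub_comm]
      exact abs_sub_lt_pi ht (h.nodes x (Multiset.mem_toFinset.1 hx))
    · exact abs_sub_lt_pi (mem_nearArc hAB (h.nodes x (Multiset.mem_toFinset.1 hx)))
        (h.nodes y (Multiset.mem_toFinset.1 hy)))
  have hlow : ∀ x ∈ insert t S.toFinset, (((t ::ₘ S).count x : ℕ) : ℕ∞) ≤
      analyticOrderAt (fun t => 1 - g t) x := by
    intro x hx
    have hx' := hnear x hx
    refine (count_le_order_sinProd _ x).trans ?_
    have : (fun t => 1 - g t) =ᶠ[nhds x] sinProd (t ::ₘ S) * q' := by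
      filter_upwards [(isOpen_Ioo.inter isOpen_Ioo).mem_nhds hx'] with y hy
      rw [h.eq y hy.1, hqq y hy]
      simp; ring
    rw [analyticOrderAt_congr this, analyticOrderAt_mul (sinProd_analytic _ _) (hq' x hx')]
    exact le_self_add
  have hsum : ∑ x ∈ insert t S.toFinset, (t ::ₘ S).count x = n + 2 := by
    rw [← Multiset.toFinset_cons, Multiset.toFinset_sum_count_eq, Multiset.card_cons, hS]
  have := (Finset.sum_le_sum hlow).trans hbound
  rw [← Nat.cast_sum, hsum] at this
  have : n + 2 ≤ n + 1 := by exact_mod_cast this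
  omega

/-- If every node is double, the cofactor is positive. -/
lemma Vanishes.cofactor_pos {n : ℕ} (hn : Odd n) {A B : ℝ} (hAB' : A ≤ B) (hAB : B - A < Real.pi)
    {X : Multiset ℝ} {g q : ℝ → ℝ} (h : Vanishes n A B (X + X) g q) (hX : (X + X).card = n + 1)
    {t : ℝ} (ht : t ∈ nearArc A B) : 0 < q t := by
  by_contra hneg
  have hall : ∀ x ∈ nearArc A B, q x < 0 := by
    intro x hx
    by_contra hpos
    have := isPreconnected_Ioo.intermediate_value ht hx
      (fun y hy => (h.analytic y hy).continuousAt.continuousWithinAt)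
      ⟨not_lt.1 hneg, not_lt.1 hpos⟩
    obtain ⟨y, hy, hy0⟩ := this
    exact h.cofactor_ne_zero hn hAB hX hy hy0
  have h1 : (A + B) / 2 - Real.pi / 2 ∈ nearArc A B := ⟨by linarith, by linarith [Real.pi_pos]⟩
  have h2 : (A + B) / 2 - Real.pi / 2 + Real.pi ∈ nearArc A B :=
    ⟨by linarith [Real.pi_pos], by linarith⟩
  have e1 := h.eq _ h1
  have e2 := h.eq _ h2
  rw [form_antiperiodic h.mem, hn.neg_one_pow] at e2
  rw [sinProd_add] at e1 e2
  nlinarith [mul_nonneg (mul_self_nonneg (sinProd X ((A + B) / 2 - Real.pi / 2)))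
    (neg_nonneg.2 (hall _ h1).le), mul_nonneg (mul_self_nonneg
    (sinProd X ((A + B) / 2 - Real.pi / 2 + Real.pi))) (neg_nonneg.2 (hall _ h2).le)]

lemma Vanishes.unique {n : ℕ} {A B : ℝ} (hAB : B - A < Real.pi) {S : Multiset ℝ}
    {g q g' q' : ℝ → ℝ} (h : Vanishes n A B S g q) (h' : Vanishes n A B S g' q')
    (hS : S.card = n + 1) {t : ℝ} (ht : t ∈ nearArc A B) : g t = g' t := by
  obtain ⟨a, S, rfl⟩ : ∃ a T, S = a ::ₘ T := by
    obtain ⟨a, ha⟩ := Multiset.card_pos_iff_exists_mem.1 (by omega : 0 < S.card)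
    exact ⟨a, _, (Multiset.cons_erase ha).symm⟩
  have ha := h.nodes a (Multiset.mem_cons_self a S)
  set r : ℝ → ℝ := fun t => Real.sin (t - a) * (q' t - q t) with hr
  have heq : ∀ t ∈ nearArc A B, (g - g') t = sinProd S t * r t := by
    intro t ht
    have e1 := h.eq t ht
    have e2 := h'.eq t ht
    simp only [sinProd_cons] at e1 e2
    simp only [Pi.sub_apply, hr]
    linear_combination e2 - e1
  obtain ⟨E, hE, hEr⟩ := form_div hAB (j := 0) (r := r)
    (fun b hb => h.nodes b (Multiset.mem_cons_of_mem hb))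
    (by simpa using hS.symm) (sub_mem h.mem h'.mem)
    (fun t ht => (show ContinuousAt (fun t => Real.sin (t - a)) t by fun_prop).mul
      ((h'.analytic t ht).continuousAt.sub (h.analytic t ht).continuousAt)) heq
  rw [pow_zero, Submodule.mem_one] at hE
  obtain ⟨c, rfl⟩ := hE
  have h0 : c = 0 := by simpa [hr] using hEr a (mem_nearArc hAB ha)
  have := heq t ht
  rw [← hEr t ht, h0] at this
  simpa [sub_eq_zero] using this

/-- Moving one double node away from `s` decreases the value at `s`. -/
lemma Vanishes.le_of_move {K : ℕ} {A B : ℝ} (hAB : B - A < Real.pi)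
    {Y : Multiset ℝ} (hY : Y.card = K) {a a' s : ℝ} (hs : s ∈ Icc A B) {g q g' q' : ℝ → ℝ}
    (h : Vanishes (2 * K + 1) A B ((a ::ₘ Y) + (a ::ₘ Y)) g q)
    (h' : Vanishes (2 * K + 1) A B ((a' ::ₘ Y) + (a' ::ₘ Y)) g' q')
    (hmove : (a' < a ∧ a ≤ s) ∨ (s ≤ a ∧ a < a')) : g' s ≤ g s := by
  have ha : a ∈ Icc A B := h.nodes a (by simp)
  have ha' : a' ∈ Icc A B := h'.nodes a' (by simp)
  have hAB' : A ≤ B := ha.1.trans ha.2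
  have hn : Odd (2 * K + 1) := ⟨K, rfl⟩
  have hq : 0 ≤ q a' := (h.cofactor_pos hn hAB' hAB (by simp; omega) (mem_nearArc hAB ha')).le
  have hq' : 0 ≤ q' a := (h'.cofactor_pos hn hAB' hAB (by simp; omega) (mem_nearArc hAB ha)).le
  set r : ℝ → ℝ := fun t => Real.sin (t - a') ^ 2 * q' t - Real.sin (t - a) ^ 2 * q t with hr
  have heq : ∀ t ∈ nearArc A B, (g - g') t = sinProd (Y + Y) t * r t := by
    intro t ht
    have e1 := h.eq t ht
    have e2 := h'.eq t ht
    simp only [sinProd_cons, sinProd_add] at e1 e2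
    simp only [Pi.sub_apply, hr, sinProd_add]
    linear_combination e2 - e1
  obtain ⟨E, hE, hEr⟩ := form_div hAB (j := 1) (r := r)
    (fun b hb => h.nodes b (by
      rw [Multiset.mem_add] at hb
      simp [hb.elim id id]))
    (by simp; omega) (sub_mem h.mem h'.mem)
    (fun t ht => ((show ContinuousAt (fun t => Real.sin (t - a') ^ 2) t by fun_prop).mul
      (h'.analytic t ht).continuousAt).sub
      ((show ContinuousAt (fun t => Real.sin (t - a) ^ 2) t by fun_prop).mul
      (h.analytic t ht).continuousAt)) heq
  rw [pow_one] at hE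
  obtain ⟨α, β, hE⟩ := mem_trigLinear hE
  have hEa : 0 ≤ E a := by
    rw [hEr a (mem_nearArc hAB ha)]
    simp only [hr, sub_self, Real.sin_zero]
    nlinarith [mul_nonneg (sq_nonneg (Real.sin (a - a'))) hq']
  have hEa' : E a' ≤ 0 := by
    rw [hEr a' (mem_nearArc hAB ha')]
    simp only [hr, sub_self, Real.sin_zero]
    nlinarith [mul_nonneg (sq_nonneg (Real.sin (a' - a))) hq]
  have hinterp : Real.sin (a - a') * E s = E a * Real.sin (s - a') + E a' * Real.sin (a - s) := by
    simp only [hE, Real.sin_sub]; ring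
  have hEs : 0 ≤ E s := by
    rcases hmove with ⟨h1, h2⟩ | ⟨h1, h2⟩
    · have p1 : 0 < Real.sin (a - a') :=
        Real.sin_pos_of_pos_of_lt_pi (by linarith) (by linarith [ha.2, ha'.1])
      have p2 : 0 ≤ Real.sin (s - a') :=
        Real.sin_nonneg_of_nonneg_of_le_pi (by linarith) (by linarith [hs.2, ha'.1])
      have p3 : Real.sin (a - s) ≤ 0 :=
        Real.sin_nonpos_of_nonpos_of_neg_pi_le (by linarith) (by linarith [hs.2, ha.1])
      have := add_nonneg (mul_nonneg hEa p2) (mul_nonneg_of_nonpos_of_nonpos hEa' p3)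
      rw [← hinterp] at this
      exact nonneg_of_mul_nonneg_right this p1
    · have p1 : Real.sin (a - a') < 0 :=
        Real.sin_neg_of_neg_of_neg_pi_lt (by linarith) (by linarith [ha.1, ha'.2])
      have p2 : Real.sin (s - a') ≤ 0 :=
        Real.sin_nonpos_of_nonpos_of_neg_pi_le (by linarith) (by linarith [hs.1, ha'.2])
      have p3 : 0 ≤ Real.sin (a - s) :=
        Real.sin_nonneg_of_nonneg_of_le_pi (by linarith) (by linarith [hs.1, ha.2])
      have := add_nonpos (mul_nonpos_of_nonneg_of_nonpos hEa p2)
        (mul_nonpos_of_nonpos_of_nonneg hEa' p3)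
      rw [← hinterp] at this
      nlinarith
  have := heq s (mem_nearArc hAB hs)
  rw [← hEr s (mem_nearArc hAB hs), sinProd_add] at this
  have h2 := mul_nonneg (mul_self_nonneg (sinProd Y s)) hEs
  rw [← this] at h2
  simpa using h2

/-- Among all choices of double nodes, the value at `s` is smallest when the nodes to the left of
`s` are moved to `A` and the others to `B`. -/
lemma Vanishes.le_of_push {K : ℕ} {A B : ℝ} (hAB : B - A < Real.pi) {s : ℝ} (hs : s ∈ Icc A B)
    (Y M : Multiset ℝ) (hcard : (M + Y).card = K + 1) {g q g₀ q₀ : ℝ → ℝ}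
    (h : Vanishes (2 * K + 1) A B ((M + Y) + (M + Y)) g q)
    (h₀ : Vanishes (2 * K + 1) A B ((M + Y.map fun x => if x ≤ s then A else B) +
      (M + Y.map fun x => if x ≤ s then A else B)) g₀ q₀) : g₀ s ≤ g s := by
  induction Y using Multiset.induction_on generalizing M g q with
  | empty =>
    rw [Multiset.map_zero] at h₀
    refine (h₀.unique hAB h (by rw [Multiset.card_add, hcard]; omega) (mem_nearArc hAB hs)).le
  | cons a Y ih =>
    have ha : a ∈ Icc A B := h.nodes a (by simp)
    set a' := if a ≤ s then A else B with ha'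
    have ha'I : a' ∈ Icc A B := by
      rw [ha']; split_ifs
      · exact ⟨le_rfl, ha.1.trans ha.2⟩
      · exact ⟨ha.1.trans ha.2, le_rfl⟩
    have hcard' : (M + Y).card = K := by
      simp only [Multiset.card_add, Multiset.card_cons] at hcard ⊢; omega
    have hnodes : ∀ x ∈ (a' ::ₘ (M + Y)) + (a' ::ₘ (M + Y)), x ∈ Icc A B := by
      intro x hx
      rw [Multiset.mem_add, or_self, Multiset.mem_cons] at hx
      rcases hx with rfl | hx
      · exact ha'I
      · refine h.nodes x ?_
        rw [Multiset.mem_add] at hx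
        simp only [Multiset.mem_add, Multiset.mem_cons]; tauto
    rw [Multiset.add_cons] at h
    obtain ⟨g₁, q₁, h₁⟩ : ∃ g₁ q₁, Vanishes (2 * K + 1) A B
        ((a' ::ₘ (M + Y)) + (a' ::ₘ (M + Y))) g₁ q₁ ∧ g₁ s ≤ g s := by
      rcases eq_or_ne a a' with haa | haa
      · rw [haa] at h
        exact ⟨g, q, h, le_rfl⟩
      · obtain ⟨g₁, q₁, h₁⟩ := exists_vanishes hAB (2 * K + 1) _ hnodes (by
          simp only [Multiset.card_add, Multiset.card_cons] at hcard' ⊢; omega)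
        refine ⟨g₁, q₁, h₁, h.le_of_move hAB hcard' hs h₁ ?_⟩
        rw [ha'] at haa ⊢
        split_ifs at haa ⊢ with hle
        · exact Or.inl ⟨lt_of_le_of_ne ha.1 haa.symm, hle⟩
        · exact Or.inr ⟨(not_le.1 hle).le, lt_of_le_of_ne ha.2 haa⟩
    refine (ih (a' ::ₘ M) (g := g₁) (q := q₁) ?_ ?_ ?_).trans h₁.2
    · simp only [Multiset.card_add, Multiset.card_cons] at hcard ⊢; omega
    · rw [Multiset.cons_add]; exact h₁.1
    · rw [Multiset.map_cons, Multiset.add_cons] at h₀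
      rw [Multiset.cons_add]; exact h₀

open Classical in
lemma exists_sinProd_factor {f : ℝ → ℝ} {J : Set ℝ} (hJo : IsOpen J) {S : Multiset ℝ}
    (hSJ : ∀ a ∈ S, a ∈ J) (hJ : ∀ a ∈ S, ∀ t ∈ J, |t - a| < Real.pi) (hf : AnalyticOnNhd ℝ f J)
    (h : ∀ a ∈ J, (S.count a : ℕ∞) ≤ analyticOrderAt f a) :
    ∃ q : ℝ → ℝ, AnalyticOnNhd ℝ q J ∧ ∀ t ∈ J, f t = sinProd S t * q t := by
  induction S using Multiset.induction_on generalizing f with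
  | empty => exact ⟨f, hf, by simp⟩
  | cons a S ih =>
    have haJ := hSJ a (Multiset.mem_cons_self a S)
    have hda := hJ a (Multiset.mem_cons_self a S)
    have h0 : f a = 0 := by
      have h1 := h a haJ
      rw [Multiset.count_cons_self] at h1
      refine apply_eq_zero_of_analyticOrderAt_ne_zero fun h2 => ?_
      rw [h2] at h1
      simp at h1
    obtain ⟨q, hq, hfq⟩ := exists_sin_factor haJ hda hf h0
    have hord : ∀ b ∈ J, (S.count b : ℕ∞) ≤ analyticOrderAt q b := by
      intro b hb
      have h1 := h b hb
      have h2 : f =ᶠ[nhds b] (fun t => Real.sin (t - a)) * q := by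
        filter_upwards [hJo.mem_nhds hb] with t ht using hfq t ht
      rw [analyticOrderAt_congr h2, analyticOrderAt_mul (by fun_prop) (hq b hb)] at h1
      rcases eq_or_ne b a with rfl | hba
      · rw [order_sin_sub_self, Multiset.count_cons_self, add_comm 1] at h1
        push_cast at h1
        exact (ENat.add_le_add_iff_right (by simp)).1 h1
      · rwa [order_sin_sub_of_ne (sin_sub_ne_zero hba (hda b hb)), zero_add,
          Multiset.count_cons_of_ne hba] at h1
    obtain ⟨q', hq', hqq⟩ := ih (fun b hb => hSJ b (Multiset.mem_cons_of_mem hb))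
      (fun b hb => hJ b (Multiset.mem_cons_of_mem hb)) hq hord
    refine ⟨q', hq', fun t ht => ?_⟩
    rw [hfq t ht, hqq t ht, sinProd_cons, mul_assoc]

/-- The coefficients of the forms that are flat to high order at both ends of an arc. -/
noncomputable def edgeCoeff (n : ℕ) (b : ℝ) : ℕ → ℝ
  | 0 => 1
  | 1 => n * b
  | j + 2 => (((n : ℝ) - 2 * (j + 1)) * b * edgeCoeff n b (j + 1) +
      ((n : ℝ) - j) * edgeCoeff n b j) / (j + 2)

lemma edgeCoeff_rec (n : ℕ) (b : ℝ) (j : ℕ) :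
    ((j : ℝ) + 2) * edgeCoeff n b (j + 2) =
      ((n : ℝ) - 2 * (j + 1)) * b * edgeCoeff n b (j + 1) + ((n : ℝ) - j) * edgeCoeff n b j := by
  have : (j : ℝ) + 2 ≠ 0 := by positivity
  rw [edgeCoeff, mul_div_cancel₀ _ this]

lemma edgeCoeff_continuous (n j : ℕ) : Continuous fun b => edgeCoeff n b j := by
  induction j using Nat.twoStepInduction with
  | zero => simp only [edgeCoeff]; fun_prop
  | one => simp only [edgeCoeff]; fun_prop
  | more j h1 h2 => simp only [edgeCoeff]; fun_prop

lemma edgeCoeff_zero_nonneg (n j : ℕ) (hj : j ≤ n) : 0 ≤ edgeCoeff n 0 j := by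
  induction j using Nat.twoStepInduction with
  | zero => simp [edgeCoeff]
  | one => simp [edgeCoeff]
  | more j h1 h2 =>
    have : (0 : ℝ) ≤ (n : ℝ) - j := sub_nonneg.2 (by exact_mod_cast (by omega : j ≤ n))
    rw [edgeCoeff, mul_zero, zero_mul, zero_add]
    exact div_nonneg (mul_nonneg this (h1 (by omega))) (by positivity)

lemma eventually_edgeCoeff_gt (n : ℕ) {δ : ℝ} (hδ : 0 < δ) :
    ∀ᶠ b in nhds (0 : ℝ), ∀ j ∈ Finset.range (n + 1), -δ < edgeCoeff n b j := by
  refine (Filter.eventually_all_finset _).2 fun j hj => ?_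
  have h0 := edgeCoeff_zero_nonneg n j (by simpa [Nat.lt_succ_iff] using hj)
  exact (edgeCoeff_continuous n j).continuousAt.eventually_const_lt (by linarith)

/-- The first `N` terms of the expansion in `u ^ j * v ^ (n - j)`. -/
noncomputable def edgeSum (n : ℕ) (b : ℝ) (u v : ℝ → ℝ) (N : ℕ) (t : ℝ) : ℝ :=
  ∑ j ∈ Finset.range N, edgeCoeff n b j * (u t ^ j * v t ^ (n - j))

lemma edgeSum_mem {n : ℕ} (b : ℝ) {u v : ℝ → ℝ} (hu : u ∈ trigLinear) (hv : v ∈ trigLinear)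
    {N : ℕ} (hN : N ≤ n + 1) : edgeSum n b u v N ∈ trigLinear ^ n := by
  have : edgeSum n b u v N = ∑ j ∈ Finset.range N, edgeCoeff n b j • (u ^ j * v ^ (n - j)) := by
    ext t; simp [edgeSum]
  rw [this]
  refine Submodule.sum_mem _ fun j hj => Submodule.smul_mem _ _ ?_
  have h := Submodule.mul_mem_mul (Submodule.pow_mem_pow _ hu j)
    (Submodule.pow_mem_pow _ hv (n - j))
  rwa [← pow_add, show j + (n - j) = n by have := Finset.mem_range.1 hj; omega] at h

lemma edgeSum_hasDerivAt {n : ℕ} {b σ : ℝ} (hσ : σ ≠ 0) {u v : ℝ → ℝ} {t : ℝ}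
    (hu : HasDerivAt u ((v t + b * u t) / σ) t) (hv : HasDerivAt v (-(u t + b * v t) / σ) t)
    {N : ℕ} (hN : N ≤ n) :
    HasDerivAt (edgeSum n b u v (N + 1)) (-(((N : ℝ) + 1) * edgeCoeff n b (N + 1) * u t ^ N *
      v t ^ (n - N) + ((n : ℝ) - N) * edgeCoeff n b N * u t ^ (N + 1) * v t ^ (n - N - 1)) / σ) t := by
  induction N with
  | zero =>
    have h := (hv.pow n)
    have e : edgeSum n b u v (0 + 1) = v ^ n := by ext x; simp [edgeSum, edgeCoeff]
    rw [e]
    refine h.congr_deriv ?_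
    rcases n with _ | n
    · simp [edgeCoeff]
    · simp only [edgeCoeff, Nat.sub_zero, Nat.add_sub_cancel]
      push_cast
      field_simp
      ring
  | succ N ih =>
    obtain ⟨m, rfl⟩ : ∃ m, n = N + 1 + m := ⟨n - (N + 1), by omega⟩
    have h := (ih (by omega)).add (((hu.pow (N + 1)).mul (hv.pow m)).const_mul
      (edgeCoeff (N + 1 + m) b (N + 1)))
    have e : edgeSum (N + 1 + m) b u v (N + 1 + 1) = edgeSum (N + 1 + m) b u v (N + 1) +
        fun x => edgeCoeff (N + 1 + m) b (N + 1) * (u ^ (N + 1) * v ^ m) x := by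
      ext x
      simp [edgeSum, Finset.sum_range_succ _ (N + 1)]
    rw [e]
    refine h.congr_deriv ?_
    have hrec := edgeCoeff_rec (N + 1 + m) b N
    set c0 := edgeCoeff (N + 1 + m) b N
    set c1 := edgeCoeff (N + 1 + m) b (N + 1)
    set c2 := edgeCoeff (N + 1 + m) b (N + 1 + 1)
    rw [show N + 1 + m - N = m + 1 by omega, show N + 1 + m - (N + 1) = m by omega]
    simp only [Pi.pow_apply, Nat.add_sub_cancel]
    field_simp
    push_cast at hrec ⊢
    rcases m with _ | m
    · simp only [Nat.cast_zero, Nat.zero_sub, pow_zero] at hrec ⊢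
      linear_combination (u t ^ (N + 1)) * hrec
    · simp only [Nat.add_sub_cancel]
      push_cast at hrec ⊢
      linear_combination (u t ^ (N + 1) * v t ^ (m + 1)) * hrec

lemma le_order_pow_mul {u h : ℝ → ℝ} {t : ℝ} (hu : AnalyticAt ℝ u t) (h0 : u t = 0)
    (hh : AnalyticAt ℝ h t) (N : ℕ) : (N : ℕ∞) ≤ analyticOrderAt (u ^ N * h) t := by
  rw [analyticOrderAt_mul (hu.pow N) hh, analyticOrderAt_pow hu]
  refine le_trans ?_ le_self_add
  have : 1 ≤ analyticOrderAt u t := by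
    rw [Order.one_le_iff_ne_zero, hu.analyticOrderAt_ne_zero]; exact h0
  calc (N : ℕ∞) = N • (1 : ℕ∞) := by simp
    _ ≤ _ := nsmul_le_nsmul_right this N

lemma edgeSum_order {n : ℕ} {b σ : ℝ} (hσ : σ ≠ 0) {u v : ℝ → ℝ} (hun : u ∈ trigLinear)
    (hvn : v ∈ trigLinear) (hu : ∀ t, HasDerivAt u ((v t + b * u t) / σ) t)
    (hv : ∀ t, HasDerivAt v (-(u t + b * v t) / σ) t) {t₀ : ℝ} (hu0 : u t₀ = 0) (hv0 : v t₀ = 1)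
    {N M : ℕ} (hNM : N + M ≤ n + 1) :
    (N : ℕ∞) ≤ analyticOrderAt (fun t => 1 - (edgeSum n b u v N + edgeSum n b v u M) t) t₀ := by
  have hua : AnalyticAt ℝ u t₀ := form_analytic (n := 1) (by simpa using hun) t₀
  have hva : AnalyticAt ℝ v t₀ := form_analytic (n := 1) (by simpa using hvn) t₀
  rcases N with _ | N
  · simp
  have e : (fun t => 1 - (edgeSum n b u v (N + 1) + edgeSum n b v u M) t) =
      (fun t => 1 - edgeSum n b u v (N + 1) t) - edgeSum n b v u M := by
    ext t; simp; ring
  have hPa : AnalyticAt ℝ (fun t => 1 - edgeSum n b u v (N + 1) t) t₀ :=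
    analyticAt_const.sub (form_analytic (edgeSum_mem b hun hvn (by omega)) t₀)
  rw [e]
  refine le_trans (le_min ?_ ?_) le_analyticOrderAt_sub
  · have h0 : 1 - edgeSum n b u v (N + 1) t₀ = 0 := by
      simp [edgeSum, Finset.sum_range_succ', hu0, hv0, edgeCoeff]
    have hd : deriv (fun t => 1 - edgeSum n b u v (N + 1) t) = u ^ N * fun t =>
        (((N : ℝ) + 1) * edgeCoeff n b (N + 1) * v t ^ (n - N) +
        ((n : ℝ) - N) * edgeCoeff n b N * u t * v t ^ (n - N - 1)) / σ := by
      ext t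
      rw [((edgeSum_hasDerivAt hσ (hu t) (hv t) (by omega : N ≤ n)).const_sub 1).deriv]
      simp only [Pi.mul_apply, Pi.pow_apply]
      field_simp
      ring
    have := hPa.analyticOrderAt_deriv_add_one
    simp only [h0, sub_zero] at this
    rw [← this, hd]
    push_cast
    gcongr
    refine le_order_pow_mul hua hu0 ?_ N
    simp only [div_eq_mul_inv]
    fun_prop
  · have : edgeSum n b v u M = u ^ (N + 1) * fun t =>
        ∑ j ∈ Finset.range M, edgeCoeff n b j * (v t ^ j * u t ^ (n - j - (N + 1))) := by
      ext t
      simp only [edgeSum, Pi.mul_apply, Pi.pow_apply, Finset.mul_sum]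
      refine Finset.sum_congr rfl fun j hj => ?_
      have := Finset.mem_range.1 hj
      rw [show u t ^ (n - j) = u t ^ (N + 1) * u t ^ (n - j - (N + 1)) by
        rw [← pow_add]; congr 1; omega]
      ring
    rw [this]
    exact le_order_pow_mul hua hu0
      (Finset.analyticAt_fun_sum _ fun j _ => by fun_prop) _

lemma edgeSum_ge {n : ℕ} {b δ : ℝ} (hδ : 0 ≤ δ) {u v : ℝ → ℝ} {t : ℝ} (hu : u t ∈ Icc 0 2)
    (hv : v t ∈ Icc 0 2) (hc : ∀ j ∈ Finset.range (n + 1), -δ < edgeCoeff n b j) {N : ℕ}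
    (hN : N ≤ n + 1) : -(N * (δ * 2 ^ n)) ≤ edgeSum n b u v N t := by
  have : ∀ j ∈ Finset.range N, -(δ * 2 ^ n) ≤ edgeCoeff n b j * (u t ^ j * v t ^ (n - j)) := by
    intro j hj
    have hj' := Finset.mem_range.1 hj
    have h1 := hc j (Finset.mem_range.2 (by omega))
    have h2 : 0 ≤ u t ^ j * v t ^ (n - j) := mul_nonneg (pow_nonneg hu.1 _) (pow_nonneg hv.1 _)
    have h3 : u t ^ j * v t ^ (n - j) ≤ 2 ^ n := by
      calc u t ^ j * v t ^ (n - j) ≤ 2 ^ j * 2 ^ (n - j) :=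
            mul_le_mul (pow_le_pow_left₀ hu.1 hu.2 _) (pow_le_pow_left₀ hv.1 hv.2 _)
              (pow_nonneg hv.1 _) (by positivity)
        _ = 2 ^ n := by rw [← pow_add]; congr 1; omega
    nlinarith [mul_le_mul_of_nonneg_left h3 hδ]
  calc -(N * (δ * 2 ^ n)) = ∑ j ∈ Finset.range N, -(δ * 2 ^ n) := by simp
    _ ≤ _ := Finset.sum_le_sum this

/-- With double nodes only at the ends of an arc slightly longer than `π / 2`, the function stays
above `-1` on the arc. -/
lemma exists_edge_vanishes (k : ℕ) (hk : 1 ≤ k) : ∃ α, Real.pi / 2 < α ∧ α < Real.pi ∧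
    ∀ A m, m ≤ k → ∃ g q, Vanishes (2 * k - 1) A (A + α)
      ((Multiset.replicate m A + Multiset.replicate (k - m) (A + α)) +
        (Multiset.replicate m A + Multiset.replicate (k - m) (A + α))) g q ∧
      ∀ s ∈ Icc A (A + α), -1 < g s := by
  obtain ⟨n, hn⟩ : ∃ n, n = 2 * k - 1 := ⟨_, rfl⟩
  have hn1 : n + 1 = 2 * k := by omega
  rw [← hn]
  set δ : ℝ := 1 / (2 * (n + 1) * 2 ^ n) with hδ
  have hδ0 : 0 < δ := by positivity
  obtain ⟨α, hα⟩ : ∃ α, ((Real.pi / 2 < α ∧ α < Real.pi) ∧ 1 / 2 < Real.sin α) ∧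
      ∀ j ∈ Finset.range (n + 1), -δ < edgeCoeff n (Real.cos α) j := by
    have h1 : ∀ᶠ α in nhdsWithin (Real.pi / 2) (Ioi (Real.pi / 2)),
        Real.pi / 2 < α ∧ α < Real.pi :=
      Ioo_mem_nhdsGT (by linarith [Real.pi_pos])
    have h2 : ∀ᶠ α in nhds (Real.pi / 2), 1 / 2 < Real.sin α :=
      Real.continuous_sin.continuousAt.eventually_const_lt (by norm_num [Real.sin_pi_div_two])
    have h3 : ∀ᶠ α in nhds (Real.pi / 2), ∀ j ∈ Finset.range (n + 1),
        -δ < edgeCoeff n (Real.cos α) j := by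
      have : Filter.Tendsto Real.cos (nhds (Real.pi / 2)) (nhds 0) := by
        simpa using Real.continuous_cos.tendsto (Real.pi / 2)
      exact this.eventually (eventually_edgeCoeff_gt n hδ0)
    exact ((h1.and (nhdsWithin_le_nhds h2)).and (nhdsWithin_le_nhds h3)).exists
  obtain ⟨⟨⟨hα1, hα2⟩, hsin⟩, hc⟩ := hα
  have hpi := Real.pi_pos
  have hσ : Real.sin α ≠ 0 := by linarith
  refine ⟨α, hα1, hα2, fun A m hm => ?_⟩
  set B := A + α with hB
  set b := Real.cos α
  set σ := Real.sin α with hσd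
  set u : ℝ → ℝ := fun t => Real.sin (t - A) / σ with hu
  set v : ℝ → ℝ := fun t => Real.sin (B - t) / σ with hv
  have hun : u ∈ trigLinear := by
    convert Submodule.smul_mem _ σ⁻¹ (sin_sub_mem A) using 1
    ext t; simp [hu, div_eq_inv_mul]
  have hvn : v ∈ trigLinear := by
    convert Submodule.smul_mem _ (-σ⁻¹) (sin_sub_mem B) using 1
    ext t
    simp only [hv, Pi.smul_apply, smul_eq_mul]
    rw [← neg_sub t B, Real.sin_neg]; ring
  have hsc : σ ^ 2 + b ^ 2 = 1 := Real.sin_sq_add_cos_sq α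
  have hu' : ∀ t, HasDerivAt u ((v t + b * u t) / σ) t := by
    intro t
    have h : HasDerivAt u (Real.cos (t - A) * 1 / σ) t :=
      (((hasDerivAt_id t).sub_const A).sin).div_const σ
    convert h using 1
    have : B - t = α - (t - A) := by rw [hB]; ring
    simp only [hu, hv, this, Real.sin_sub α]
    field_simp
    ring
  have hv' : ∀ t, HasDerivAt v (-(u t + b * v t) / σ) t := by
    intro t
    have h : HasDerivAt v (Real.cos (B - t) * (-1) / σ) t :=
      (((hasDerivAt_id t).const_sub B).sin).div_const σ
    convert h using 1
    have : t - A = α - (B - t) := by rw [hB]; ring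
    simp only [hu, hv, this, Real.sin_sub α]
    field_simp
    ring
  have huA : u A = 0 := by simp [hu]
  have hvA : v A = 1 := by simp [hv, hB, ← hσd, hσ]
  have huB : u B = 1 := by simp [hu, hB, ← hσd, hσ]
  have hvB : v B = 0 := by simp [hv]
  set N := 2 * m
  set M := 2 * (k - m)
  have hNM : N + M = n + 1 := by omega
  set g := edgeSum n b u v N + edgeSum n b v u M with hg
  have hgm : g ∈ trigLinear ^ n :=
    add_mem (edgeSum_mem b hun hvn (by omega)) (edgeSum_mem b hvn hun (by omega))
  have hAord : (N : ℕ∞) ≤ analyticOrderAt (fun t => 1 - g t) A :=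
    edgeSum_order hσ hun hvn hu' hv' huA hvA hNM.le
  have hBord : (M : ℕ∞) ≤ analyticOrderAt (fun t => 1 - g t) B := by
    rw [hg, add_comm]
    refine edgeSum_order (σ := -σ) (neg_ne_zero.2 hσ) hvn hun (fun t => ?_) (fun t => ?_)
      hvB huB (by omega)
    · convert hv' t using 1; field_simp
    · convert hu' t using 1; field_simp
  set X := Multiset.replicate m A + Multiset.replicate (k - m) B with hX
  have hAB : B - A < Real.pi := by rw [hB]; linarith
  have hABlt : A < B := by rw [hB]; linarith
  have hnodes : ∀ a ∈ X + X, a ∈ Icc A B := by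
    intro a ha
    simp only [hX, Multiset.mem_add, Multiset.mem_replicate, or_self] at ha
    rcases ha with ⟨-, rfl⟩ | ⟨-, rfl⟩
    · exact ⟨le_rfl, hABlt.le⟩
    · exact ⟨hABlt.le, le_rfl⟩
  obtain ⟨q, hq, hgq⟩ := exists_sinProd_factor (f := fun t => 1 - g t) (J := nearArc A B)
    isOpen_Ioo (S := X + X) (fun a ha => mem_nearArc hAB (hnodes a ha))
    (fun a ha t ht => abs_sub_lt_pi ht (hnodes a ha))
    (fun t _ => analyticAt_const.sub (form_analytic hgm t)) (by
      classical
      intro a _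
      simp only [hX, Multiset.count_add, Multiset.count_replicate]
      split_ifs with h1 h2 h2
      · exact absurd (h1.trans h2.symm) hABlt.ne
      · rw [← h1]; convert hAord using 2; omega
      · rw [← h2]; convert hBord using 2; omega
      · simp)
  refine ⟨g, q, ⟨hgm, hnodes, hq, hgq⟩, fun s hs => ?_⟩
  have hbd : ∀ x, 0 ≤ x → x ≤ α → Real.sin x / σ ∈ Icc (0 : ℝ) 2 := by
    intro x h0 h1
    have hs0 : 0 < σ := by linarith
    refine ⟨div_nonneg (Real.sin_nonneg_of_nonneg_of_le_pi h0 (by linarith)) hs0.le, ?_⟩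
    rw [div_le_iff₀ hs0]
    linarith [Real.sin_le_one x]
  have hus := hbd (s - A) (by linarith [hs.1]) (by linarith [hs.2])
  have hvs := hbd (B - s) (by linarith [hs.2]) (by linarith [hs.1])
  have h1 := edgeSum_ge (u := u) (v := v) hδ0.le hus hvs hc (by omega : N ≤ n + 1)
  have h2 := edgeSum_ge (u := v) (v := u) hδ0.le hvs hus hc (by omega : M ≤ n + 1)
  have h3 : ((N : ℝ) + M) * (δ * 2 ^ n) = 1 / 2 := by
    rw [show (N : ℝ) + M = n + 1 by exact_mod_cast hNM, hδ]
    field_simp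
  rw [hg, Pi.add_apply]
  linarith

/-- The span of the functions `cos (i * t)` and `sin (i * t)` with `|i| ≤ n` and `i` of the parity
of `n`. -/
noncomputable def harmonics (n : ℕ) : Submodule ℝ (ℝ → ℝ) :=
  Submodule.span ℝ {f | ∃ i : ℤ, |i| ≤ n ∧ Even (n - i) ∧
    ((f = fun t => Real.cos (i * t)) ∨ f = fun t => Real.sin (i * t))}

lemma cos_mem_harmonics {n : ℕ} {i : ℤ} (h : |i| ≤ n) (hp : Even (n - i)) :
    (fun t => Real.cos (i * t)) ∈ harmonics n :=
  Submodule.subset_span ⟨i, h, hp, Or.inl rfl⟩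

lemma sin_mem_harmonics {n : ℕ} {i : ℤ} (h : |i| ≤ n) (hp : Even (n - i)) :
    (fun t => Real.sin (i * t)) ∈ harmonics n :=
  Submodule.subset_span ⟨i, h, hp, Or.inr rfl⟩

lemma mul_mem_harmonics {n : ℕ} {l g : ℝ → ℝ} (hl : l ∈ trigLinear) (hg : g ∈ harmonics n) :
    l * g ∈ harmonics (n + 1) := by
  obtain ⟨a, b, rfl⟩ := mem_trigLinear hl
  suffices h : harmonics n ≤ (harmonics (n + 1)).comap
      (LinearMap.mulLeft ℝ (fun t => a * Real.sin t + b * Real.cos t)) from h hg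
  refine Submodule.span_le.2 ?_
  rintro f ⟨i, hi, hp, hf⟩
  have hi' := abs_le.1 hi
  have b1 : |i + 1| ≤ ((n + 1 : ℕ) : ℤ) := by rw [abs_le]; push_cast; omega
  have b2 : |i - 1| ≤ ((n + 1 : ℕ) : ℤ) := by rw [abs_le]; push_cast; omega
  have e1 : Even (((n + 1 : ℕ) : ℤ) - (i + 1)) := by
    rwa [show ((n + 1 : ℕ) : ℤ) - (i + 1) = n - i by push_cast; ring]
  have e2 : Even (((n + 1 : ℕ) : ℤ) - (i - 1)) := by
    rw [show ((n + 1 : ℕ) : ℤ) - (i - 1) = n - i + 2 by push_cast; ring]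
    exact hp.add even_two
  have c1 := cos_mem_harmonics b1 e1
  have c2 := cos_mem_harmonics b2 e2
  have s1 := sin_mem_harmonics b1 e1
  have s2 := sin_mem_harmonics b2 e2
  push_cast at c1 c2 s1 s2
  simp only [add_mul, sub_mul, one_mul, Real.cos_add, Real.cos_sub, Real.sin_add, Real.sin_sub]
    at c1 c2 s1 s2
  change (fun t => a * Real.sin t + b * Real.cos t) * f ∈ harmonics (n + 1)
  rcases hf with rfl | rfl
  · convert add_mem (Submodule.smul_mem _ (a / 2) (sub_mem s1 s2))
      (Submodule.smul_mem _ (b / 2) (add_mem c1 c2)) using 1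
    ext t
    simp only [Pi.mul_apply, Pi.add_apply, Pi.smul_apply, Pi.sub_apply, smul_eq_mul]
    ring
  · convert add_mem (Submodule.smul_mem _ (a / 2) (sub_mem c2 c1))
      (Submodule.smul_mem _ (b / 2) (add_mem s1 s2)) using 1
    ext t
    simp only [Pi.mul_apply, Pi.add_apply, Pi.smul_apply, Pi.sub_apply, smul_eq_mul]
    ring

lemma form_mem_harmonics {n : ℕ} {f : ℝ → ℝ} (hf : f ∈ trigLinear ^ n) : f ∈ harmonics n := by
  refine form_induction (C := fun n f => f ∈ harmonics n) (fun r => ?_)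
    (fun n f g => add_mem) (fun n l hl g _ hg => mul_mem_harmonics hl hg) hf
  convert Submodule.smul_mem _ r (cos_mem_harmonics (n := 0) (i := 0) (by simp) (by simp)) using 1
  ext t; simp

/-- A form of degree `2 k - 1` is a linear functional evaluated along the curve `Uk k`. -/
lemma exists_linear_of_form {k : ℕ} {f : ℝ → ℝ} (hf : f ∈ trigLinear ^ (2 * k - 1)) (hk : 1 ≤ k) :
    ∃ l : (Fin (2 * k) → ℝ) →ₗ[ℝ] ℝ, ∀ t, l (Uk k t) = f t := by
  let L : Module.Dual ℝ (Fin (2 * k) → ℝ) →ₗ[ℝ] (ℝ → ℝ) :=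
    LinearMap.pi fun t => Module.Dual.eval ℝ _ (Uk k t)
  suffices h : harmonics (2 * k - 1) ≤ LinearMap.range L by
    obtain ⟨l, hl⟩ := h (form_mem_harmonics hf)
    exact ⟨l, fun t => congrFun hl t⟩
  refine Submodule.span_le.2 ?_
  rintro f ⟨i, hi, hp, hf⟩
  rw [abs_le] at hi
  have hodd : ∃ z : ℤ, i = 2 * z + 1 := by
    obtain ⟨w, hw⟩ := hp
    exact ⟨k - 1 - w, by omega⟩
  obtain ⟨j, hj, hij⟩ : ∃ j : ℕ, j < k ∧ (i = 2 * j + 1 ∨ i = -(2 * j + 1)) := by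
    obtain ⟨z, hz⟩ := hodd
    rcases le_total 0 z with h | h
    · exact ⟨z.toNat, by omega, by omega⟩
    · rcases eq_or_lt_of_le h with h | h
      · exact ⟨0, by omega, by omega⟩
      · exact ⟨(-z - 1).toNat, by omega, by omega⟩
  have hcos : ∀ t : ℝ, Real.cos (i * t) = Real.cos ((2 * j + 1) * t) := by
    intro t
    rcases hij with rfl | rfl <;> push_cast
    · rfl
    · rw [neg_mul, Real.cos_neg]
  have hsin : ∃ c : ℝ, ∀ t : ℝ, Real.sin (i * t) = c * Real.sin ((2 * j + 1) * t) := by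
    rcases hij with rfl | rfl <;> push_cast
    · exact ⟨1, fun t => by ring⟩
    · exact ⟨-1, fun t => by rw [neg_mul, Real.sin_neg]; ring⟩
  rcases hf with rfl | rfl
  · refine ⟨LinearMap.proj ⟨2 * j, by omega⟩, ?_⟩
    ext t
    simp [L, Uk, hcos]
  · obtain ⟨c, hc⟩ := hsin
    refine ⟨c • LinearMap.proj ⟨2 * j + 1, by omega⟩, ?_⟩
    ext t
    simp [L, Uk, hc]

lemma form_periodic {n : ℕ} {f : ℝ → ℝ} (hf : f ∈ trigLinear ^ n) :
    Function.Periodic f (2 * Real.pi) := by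
  intro t
  rw [two_mul, ← add_assoc, form_antiperiodic hf, form_antiperiodic hf, ← mul_assoc, ← mul_pow]
  simp

lemma Uk_periodic (k : ℕ) : Function.Periodic (Uk k) (2 * Real.pi) := by
  intro t
  ext j
  simp only [Uk]
  split_ifs
  · rw [← Real.cos_add_nat_mul_two_pi ((j.val + 1) * t) (j.val + 1)]; push_cast; ring_nf
  · rw [← Real.sin_add_nat_mul_two_pi (j.val * t) j.val]; ring_nf

lemma map_ite_eq_replicate (A B s : ℝ) (Y : Multiset ℝ) :
    ∃ m ≤ Y.card, (Y.map fun x => if x ≤ s then A else B) =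
      Multiset.replicate m A + Multiset.replicate (Y.card - m) B := by
  induction Y using Multiset.induction_on with
  | empty => exact ⟨0, by simp⟩
  | cons a Y ih =>
    obtain ⟨m, hm, h⟩ := ih
    rw [Multiset.map_cons, h, Multiset.card_cons]
    split_ifs
    · refine ⟨m + 1, by omega, ?_⟩
      rw [Multiset.replicate_succ, Multiset.cons_add, Nat.add_sub_add_right]
    · refine ⟨m, by omega, ?_⟩
      rw [Nat.succ_sub hm, Multiset.replicate_succ, Multiset.add_cons]

/-- A form of odd degree that supports the curve exactly at the points of `T`. -/
lemma exists_supporting_form (k : ℕ) (hk : 1 ≤ k) : ∃ α : ℝ, Real.pi / 2 < α ∧ α < Real.pi ∧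
    ∀ T : Finset ℝ, 1 ≤ T.card → T.card ≤ k → (∀ a ∈ T, ∀ b ∈ T, b - a < α) →
      ∃ g ∈ trigLinear ^ (2 * k - 1), (∀ t, g t ≤ 1) ∧ (∀ t ∈ T, g t = 1) ∧
        (∀ t, g t = 1 → ∃ x ∈ T, Uk k t = Uk k x) ∧ ∃ t, g t < 1 := by
  obtain ⟨α, hα1, hα2, hedge⟩ := exists_edge_vanishes k hk
  refine ⟨α, hα1, hα2, fun T hT1 hTk hT => ?_⟩
  have hpi := Real.pi_pos
  obtain ⟨K, rfl⟩ : ∃ K, k = K + 1 := ⟨k - 1, by omega⟩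
  rw [show 2 * (K + 1) - 1 = 2 * K + 1 by omega] at hedge ⊢
  have hodd : Odd (2 * K + 1) := ⟨K, rfl⟩
  have hTne : T.Nonempty := Finset.card_pos.1 hT1
  set A := T.min' hTne
  set B := A + α with hB
  have hAB : B - A < Real.pi := by rw [hB]; linarith
  have hABlt : A < B := by rw [hB]; linarith
  have hTI : ∀ x ∈ T, x ∈ Icc A B := fun x hx =>
    ⟨T.min'_le x hx, by linarith [hT A (T.min'_mem hTne) x hx]⟩
  set X : Multiset ℝ := T.val + Multiset.replicate (K + 1 - T.card) A with hX
  have hXcard : X.card = K + 1 := by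
    rw [hX, Multiset.card_add, Multiset.card_replicate, Finset.card_val]; omega
  have hXT : ∀ x, x ∈ X ↔ x ∈ T := by
    intro x
    rw [hX, Multiset.mem_add, Multiset.mem_replicate, Finset.mem_val]
    exact ⟨fun h => h.elim id fun h => h.2 ▸ T.min'_mem hTne, Or.inl⟩
  have hXX : (X + X).card = 2 * K + 1 + 1 := by rw [Multiset.card_add, hXcard]; omega
  obtain ⟨g, q, h⟩ := exists_vanishes hAB (2 * K + 1) (X + X)
    (fun a ha => hTI a ((hXT a).1 (by simpa using ha))) hXX.le
  have hnear : ∀ t ∈ nearArc A B, g t ≤ 1 ∧ (g t = 1 ↔ t ∈ T) := by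
    intro t ht
    have hq := h.cofactor_pos hodd hABlt.le hAB hXX ht
    have e := h.eq t ht
    rw [sinProd_add] at e
    refine ⟨by nlinarith [mul_nonneg (mul_self_nonneg (sinProd X t)) hq.le], fun h1 => ?_,
      fun h1 => ?_⟩
    · by_contra hn
      have := sinProd_ne_zero (S := X) (t := t)
        (fun a ha => abs_sub_lt_pi ht (hTI a ((hXT a).1 ha))) (fun h' => hn ((hXT t).1 h'))
      rw [h1, sub_self, eq_comm] at e
      exact (mul_ne_zero (mul_ne_zero this this) hq.ne') e
    · rw [sinProd_eq_zero ((hXT t).2 h1)] at e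
      linarith
  have harc : ∀ s ∈ Icc A B, -1 < g s := by
    intro s hs
    obtain ⟨m, hm, hmap⟩ := map_ite_eq_replicate A B s X
    rw [hXcard] at hm hmap
    obtain ⟨g₀, q₀, h₀, hg₀⟩ := hedge A m hm
    refine (hg₀ s hs).trans_le (Vanishes.le_of_push hAB hs X 0 (by rw [zero_add, hXcard])
      (q := q) (q₀ := q₀) ?_ ?_)
    · simpa only [zero_add] using h
    · simpa only [zero_add, hmap] using h₀
  have hfar : ∀ t ∈ Icc (A + Real.pi) (B + Real.pi), g t < 1 := by
    intro t ht
    have h1 := form_antiperiodic h.mem (t - Real.pi)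
    rw [sub_add_cancel, hodd.neg_one_pow] at h1
    have h2 := harc (t - Real.pi) ⟨by linarith [ht.1], by linarith [ht.2]⟩
    linarith
  have hall : ∀ t, g t ≤ 1 ∧ (g t = 1 → ∃ x ∈ T, Uk (K + 1) t = Uk (K + 1) x) := by
    intro t
    obtain ⟨t', ht', h1, h2⟩ : ∃ t' ∈ Ioc (B - Real.pi) (B - Real.pi + 2 * Real.pi),
        g t = g t' ∧ Uk (K + 1) t = Uk (K + 1) t' :=
      ⟨toIocMod Real.two_pi_pos (B - Real.pi) t, toIocMod_mem_Ioc _ _ _,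
        ((form_periodic h.mem).sub_zsmul_eq _).symm, ((Uk_periodic (K + 1)).sub_zsmul_eq _).symm⟩
    rw [h1, h2]
    by_cases hlt : t' < A + Real.pi
    · have := hnear t' ⟨ht'.1, hlt⟩
      exact ⟨this.1, fun h => ⟨t', this.2.1 h, rfl⟩⟩
    · have := hfar t' ⟨not_lt.1 hlt, by linarith [ht'.2]⟩
      exact ⟨this.le, fun h => absurd h this.ne⟩
  exact ⟨g, h.mem, fun t => (hall t).1,
    fun t ht => (hnear t (mem_nearArc hAB (hTI t ht))).2.2 ht, fun t => (hall t).2,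
    A + Real.pi, hfar _ ⟨le_rfl, by linarith⟩⟩

/-- The points of `S` where a linear functional attains its maximum over `S` span a face. -/
lemma isProperFace_convexHull {E : Type*} [AddCommGroup E] [Module ℝ E] [TopologicalSpace E]
    {S F : Set E} (l : StrongDual ℝ E) (hFS : F ⊆ S) (hF : F.Nonempty) (hle : ∀ x ∈ S, l x ≤ 1)
    (hF1 : ∀ x ∈ F, l x = 1) (hSF : ∀ x ∈ S, l x = 1 → x ∈ F) (hlt : ∃ x ∈ S, l x < 1) :
    IsProperFace (convexHull ℝ S) (convexHull ℝ F) := by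
  have hconv : Convex ℝ {x | l x ≤ 1 ∧ (l x = 1 → x ∈ convexHull ℝ F)} := by
    rintro x ⟨hx, hx'⟩ y ⟨hy, hy'⟩ a b ha hb hab
    have e : l (a • x + b • y) = a * l x + b * l y := by simp
    refine ⟨?_, fun h1 => ?_⟩
    · rw [e]; nlinarith
    · rw [e] at h1
      rcases eq_or_lt_of_le ha with rfl | ha'
      · obtain rfl : b = 1 := by linarith
        simpa using hy' (by linarith)
      · rcases eq_or_lt_of_le hb with rfl | hb'
        · obtain rfl : a = 1 := by linarith
          simpa using hx' (by linarith)
        · have hx1 : l x = 1 := le_antisymm hx (by nlinarith)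
          have hy1 : l y = 1 := le_antisymm hy (by nlinarith)
          exact convex_convexHull ℝ F (hx' hx1) (hy' hy1) ha hb hab
  have hS : convexHull ℝ S ⊆ {x | l x ≤ 1 ∧ (l x = 1 → x ∈ convexHull ℝ F)} :=
    convexHull_min (fun x hx => ⟨hle x hx, fun h => subset_convexHull ℝ F (hSF x hx h)⟩) hconv
  have hF1' : ∀ x ∈ convexHull ℝ F, l x = 1 := fun x hx =>
    convexHull_min (t := {x | l x = 1}) hF1
      (convex_hyperplane (f := l) l.toLinearMap.isLinear 1) hx
  refine ⟨hF.convexHull, fun h => ?_, fun _ => ⟨l, Set.ext fun x => ⟨fun hx => ?_, fun hx => ?_⟩⟩⟩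
  · obtain ⟨x, hx, hx1⟩ := hlt
    exact hx1.ne (hF1' x (h ▸ subset_convexHull ℝ S hx))
  · exact ⟨convexHull_mono hFS hx, fun y hy => (hS hy).1.trans_eq (hF1' x hx).symm⟩
  · obtain ⟨y, hy⟩ := hF
    refine (hS hx.1).2 (le_antisymm (hS hx.1).1 ?_)
    rw [← hF1 y hy]
    exact hx.2 y (subset_convexHull ℝ S (hFS hy))

theorem stmt6 (k : ℕ) (hk : 1 ≤ k) :
    ∃ α : ℝ, Real.pi / 2 < α ∧ α < Real.pi ∧
      ∀ T : Finset ℝ, 1 ≤ T.card → T.card ≤ k →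
        (∀ a ∈ T, ∀ b ∈ T, b - a < α) →
        IsProperFace (convexHull ℝ (Set.range (Uk k))) (convexHull ℝ (Uk k '' ↑T)) := by
  obtain ⟨α, hα1, hα2, h⟩ := exists_supporting_form k hk
  refine ⟨α, hα1, hα2, fun T hT1 hTk hT => ?_⟩
  obtain ⟨g, hg, hle, hT', hface, s, hs⟩ := h T hT1 hTk hT
  obtain ⟨l, hl⟩ := exists_linear_of_form hg hk
  refine isProperFace_convexHull (LinearMap.toContinuousLinearMap l) (image_subset_range _ _)
    ((Finset.coe_nonempty.2 (Finset.card_pos.1 hT1)).image _) ?_ ?_ ?_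
    ⟨Uk k s, mem_range_self s, by simpa [hl] using hs⟩
  · rintro _ ⟨t, rfl⟩
    simpa [hl] using hle t
  · rintro _ ⟨t, ht, rfl⟩
    simpa [hl] using hT' t ht
  · rintro _ ⟨t, rfl⟩ h1
    obtain ⟨x, hx, hxt⟩ := hface t (by simpa [hl] using h1)
    exact ⟨x, hx, hxt.symm⟩
end

section
/- For every even integer N ≥ 8 there exists a centrally symmetric geometric simplicial complex J_N (in some ℝ^M) with exactly N vertices such that the underlying space of J_N is homeomorphic to the unit 3-sphere S³ = {x ∈ ℝ⁴ : |x| = 1} and J_N is cs 2-neighborly; in particular, J_N has exactly C(N,2) − N/2 edges (1-dimensional simplices). -/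
open Set

/-- A geometric simplicial complex `K` (with vertex involution `φ`) is centrally symmetric:
`φ` is an involution of the vertex set carrying the vertex set of each face to the vertex set
of a face, and moving the vertex set of every face. -/
def IsCSComplex {E : Type*} [DecidableEq E] [AddCommGroup E] [Module ℝ E]
    (K : Geometry.SimplicialComplex ℝ E) (φ : E → E) : Prop :=
  (∀ v ∈ K.vertices, φ v ∈ K.vertices) ∧
  (∀ v ∈ K.vertices, φ (φ v) = v) ∧
  (∀ s ∈ K.faces, s.image φ ∈ K.faces) ∧
  (∀ s ∈ K.faces, s.image φ ≠ s)

/-! ### Geometric realization of an abstract simplicial complex -/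

section Realization

variable {V : Type*}

/-- The geometric realization of a family `K` of finite sets, in barycentric coordinates: the
finitely supported probability weights whose support belongs to `K`. -/
def realization (K : Set (Finset V)) : Set (V → ℝ) :=
  {x | ∃ s ∈ K, (∀ i ∈ s, 0 < x i) ∧ (∀ i ∉ s, x i = 0) ∧ ∑ i ∈ s, x i = 1}

lemma nonneg_of_mem_realization {K : Set (Finset V)} {x : V → ℝ} (hx : x ∈ realization K)
    (i : V) : 0 ≤ x i := by
  obtain ⟨s, -, hpos, hzero, -⟩ := hx
  by_cases hi : i ∈ s
  · exact (hpos i hi).le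
  · exact (hzero i hi).ge

lemma inf'_eq_zero_of_mem_realization {K : Set (Finset V)} {x : V → ℝ} (hx : x ∈ realization K)
    {σ : Finset V} (hσ : σ.Nonempty) (h : ∃ i ∈ σ, x i = 0) : σ.inf' hσ x = 0 := by
  obtain ⟨i, hi, h0⟩ := h
  exact le_antisymm (h0 ▸ Finset.inf'_le x hi)
    (Finset.le_inf' hσ x fun j _ => nonneg_of_mem_realization hx j)

variable [DecidableEq V]

/-- `K'` contains the result of the bistellar flip of `K` replacing `σ * ∂τ` by `∂σ * τ`. -/
structure FlipsTo (σ τ : Finset V) (K K' : Set (Finset V)) : Prop where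
  not_subset : ∀ s ∈ K, ¬τ ⊆ s
  star : ∀ s ∈ K, σ ⊆ s → s ⊆ σ ∪ τ
  outside : ∀ s ∈ K, ¬σ ⊆ s → s ∈ K'
  new : ∀ s, τ ⊆ s → s ⊆ σ ∪ τ → ¬σ ⊆ s → s ∈ K'

/-- The piecewise linear map underlying the flip exchanging `σ` and `τ`. -/
noncomputable def flipMap (σ τ : Finset V) (hσ : σ.Nonempty) (x : V → ℝ) : V → ℝ := fun i =>
  x i + σ.inf' hσ x * ((if i ∈ τ then (σ.card : ℝ) / τ.card else 0) - if i ∈ σ then 1 else 0)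

lemma continuous_flipMap (σ τ : Finset V) (hσ : σ.Nonempty) :
    Continuous (flipMap σ τ hσ) := by
  have h : Continuous fun x : V → ℝ => σ.inf' hσ x := by
    have := Continuous.finset_inf'_apply (f := fun (i : V) (x : V → ℝ) => x i) hσ
      (fun i _ => continuous_apply i)
    exact this
  unfold flipMap
  fun_prop

lemma FlipsTo.mapsTo {σ τ : Finset V} {K K' : Set (Finset V)} (h : FlipsTo σ τ K K')
    (hσ : σ.Nonempty) (hτ : τ.Nonempty) (hd : Disjoint σ τ) :
    MapsTo (flipMap σ τ hσ) (realization K) (realization K') := by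
  intro x hx
  obtain ⟨s, hs, hpos, hzero, hsum⟩ := id hx
  by_cases hσs : σ ⊆ s
  · have hsub := h.star s hs hσs
    obtain ⟨i₀, hi₀, hmin⟩ := Finset.exists_mem_eq_inf' hσ x
    have hμ : 0 < σ.inf' hσ x := hmin ▸ hpos i₀ (hσs hi₀)
    have hle : ∀ i ∈ σ, σ.inf' hσ x ≤ x i := fun i hi => Finset.inf'_le x hi
    have hc : 0 < (σ.card : ℝ) / τ.card := by
      have := hσ.card_pos; have := hτ.card_pos; positivity
    have hval : ∀ i ∈ σ, flipMap σ τ hσ x i = x i - σ.inf' hσ x := by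
      intro i hi
      have : i ∉ τ := Finset.disjoint_left.1 hd hi
      simp [flipMap, hi, this, sub_eq_add_neg]
    have hvalτ : ∀ i ∈ τ, flipMap σ τ hσ x i = x i + σ.inf' hσ x * (σ.card / τ.card) := by
      intro i hi
      have : i ∉ σ := Finset.disjoint_right.1 hd hi
      simp [flipMap, hi, this]
    have hvalo : ∀ i ∉ σ ∪ τ, flipMap σ τ hσ x i = 0 := by
      intro i hi
      have h1 : i ∉ σ := fun h => hi (Finset.mem_union_left _ h)
      have h2 : i ∉ τ := fun h => hi (Finset.mem_union_right _ h)
      simp [flipMap, h1, h2, hzero i fun h => hi (hsub h)]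
    have hposτ : ∀ i ∈ τ, 0 < flipMap σ τ hσ x i := fun i hi => by
      rw [hvalτ i hi]
      have := nonneg_of_mem_realization hx i
      positivity
    have hnonneg : ∀ i, 0 ≤ flipMap σ τ hσ x i := by
      intro i
      by_cases h1 : i ∈ σ
      · rw [hval i h1]; linarith [hle i h1]
      by_cases h2 : i ∈ τ
      · exact (hposτ i h2).le
      · exact (hvalo i (by simp [h1, h2])).ge
    refine ⟨(σ ∪ τ).filter fun i => 0 < flipMap σ τ hσ x i, h.new _ ?_ ?_ ?_, ?_, ?_, ?_⟩
    · exact fun i hi => Finset.mem_filter.2 ⟨Finset.mem_union_right _ hi, hposτ i hi⟩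
    · exact Finset.filter_subset _ _
    · intro hsub'
      have := (Finset.mem_filter.1 (hsub' hi₀)).2
      rw [hval i₀ hi₀, hmin, sub_self] at this
      exact lt_irrefl _ this
    · exact fun i hi => (Finset.mem_filter.1 hi).2
    · intro i hi
      by_cases hu : i ∈ σ ∪ τ
      · exact le_antisymm (not_lt.1 fun hlt => hi (Finset.mem_filter.2 ⟨hu, hlt⟩)) (hnonneg i)
      · exact hvalo i hu
    · rw [Finset.sum_filter_of_ne fun i _ hne => lt_of_le_of_ne (hnonneg i) hne.symm]
      have hx1 : ∑ i ∈ σ ∪ τ, x i = 1 := by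
        rw [← hsum]
        exact (Finset.sum_subset hsub fun i _ hi => hzero i hi).symm
      rw [Finset.sum_union hd] at hx1 ⊢
      rw [Finset.sum_congr rfl hval, Finset.sum_congr rfl hvalτ, Finset.sum_sub_distrib,
        Finset.sum_add_distrib, Finset.sum_const, Finset.sum_const, nsmul_eq_mul, nsmul_eq_mul]
      have : (τ.card : ℝ) ≠ 0 := by exact_mod_cast hτ.card_pos.ne'
      field_simp
      linarith
  · have h0 : σ.inf' hσ x = 0 := by
      obtain ⟨i, hi, his⟩ := Finset.not_subset.1 hσs
      exact inf'_eq_zero_of_mem_realization hx hσ ⟨i, hi, hzero i his⟩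
    have : flipMap σ τ hσ x = x := by ext i; simp [flipMap, h0]
    rw [this]
    exact ⟨s, h.outside s hs hσs, hpos, hzero, hsum⟩

lemma FlipsTo.flipMap_flipMap {σ τ : Finset V} {K K' : Set (Finset V)} (h : FlipsTo σ τ K K')
    (hσ : σ.Nonempty) (hτ : τ.Nonempty) (hd : Disjoint σ τ) {x : V → ℝ}
    (hx : x ∈ realization K) : flipMap τ σ hτ (flipMap σ τ hσ x) = x := by
  have hτx : ∃ i ∈ τ, x i = 0 := by
    obtain ⟨s, hs, -, hzero, -⟩ := hx
    obtain ⟨i, hi, his⟩ := Finset.not_subset.1 (h.not_subset s hs)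
    exact ⟨i, hi, hzero i his⟩
  have hcσ : (σ.card : ℝ) ≠ 0 := by exact_mod_cast hσ.card_pos.ne'
  have hcτ : (τ.card : ℝ) ≠ 0 := by exact_mod_cast hτ.card_pos.ne'
  have hvalτ : ∀ i ∈ τ, flipMap σ τ hσ x i = x i + σ.inf' hσ x * (σ.card / τ.card) := by
    intro i hi
    have : i ∉ σ := Finset.disjoint_right.1 hd hi
    simp [flipMap, hi, this]
  have hinf : τ.inf' hτ (flipMap σ τ hσ x) = σ.inf' hσ x * (σ.card / τ.card) := by
    apply le_antisymm
    · obtain ⟨i, hi, h0⟩ := hτx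
      have := Finset.inf'_le (flipMap σ τ hσ x) hi
      rwa [hvalτ i hi, h0, zero_add] at this
    · refine Finset.le_inf' _ _ fun i hi => ?_
      rw [hvalτ i hi]
      linarith [nonneg_of_mem_realization hx i]
  ext i
  rw [flipMap, hinf, flipMap]
  by_cases h1 : i ∈ σ
  · have : i ∉ τ := Finset.disjoint_left.1 hd h1
    simp only [h1, this, if_true, if_false]
    field_simp
    ring
  · by_cases h2 : i ∈ τ
    · simp only [h1, h2, if_true, if_false]
      field_simp
      ring
    · simp [h1, h2]

/-- Bistellar flips do not change the homeomorphism type of the realization. -/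
lemma nonempty_homeomorph_of_flipsTo {σ τ : Finset V} {K K' : Set (Finset V)}
    (h : FlipsTo σ τ K K') (h' : FlipsTo τ σ K' K) (hσ : σ.Nonempty) (hτ : τ.Nonempty)
    (hd : Disjoint σ τ) : Nonempty (realization K ≃ₜ realization K') :=
  ⟨{  toFun := (h.mapsTo hσ hτ hd).restrict
      invFun := (h'.mapsTo hτ hσ hd.symm).restrict
      left_inv := fun x => Subtype.ext (h.flipMap_flipMap hσ hτ hd x.2)
      right_inv := fun x => Subtype.ext (h'.flipMap_flipMap hτ hσ hd.symm x.2)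
      continuous_toFun := (continuous_flipMap σ τ hσ).restrict _
      continuous_invFun := (continuous_flipMap τ σ hτ).restrict _ }⟩

end Realization

/-! ### Bistellar flips and stacked balls -/

section Stacked

variable {V : Type*} [DecidableEq V]

/-- An abstract simplicial complex of dimension at most 3 (containing the empty face) in which
every triangle lies in at most two tetrahedra. -/
structure IsThreePseudomanifold (K : Set (Finset V)) : Prop where
  lower : IsLowerSet K
  card_le : ∀ s ∈ K, s.card ≤ 4
  not_three : ∀ t : Finset V, t.card = 3 → ∀ a b c : V, a ∉ t → b ∉ t → c ∉ t →
    a ≠ b → a ≠ c → b ≠ c → insert a t ∈ K → insert b t ∈ K → insert c t ∉ K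

/-- The bistellar flip replacing `σ * ∂τ` by `∂σ * τ`. -/
def bistellarFlip (σ τ : Finset V) (K : Set (Finset V)) : Set (Finset V) :=
  {s | (s ∈ K ∧ ¬σ ⊆ s) ∨ (τ ⊆ s ∧ s ⊆ σ ∪ τ ∧ ¬σ ⊆ s)}

/-- `σ * ∂τ` is the star of `σ` in the 3-dimensional complex `K` and `τ ∉ K`. -/
structure IsFlippable (σ τ : Finset V) (K : Set (Finset V)) : Prop where
  nonempty_left : σ.Nonempty
  nonempty_right : τ.Nonempty
  disjoint : Disjoint σ τ
  card_union : (σ ∪ τ).card = 5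
  not_subset : ∀ s ∈ K, ¬τ ⊆ s
  star : ∀ s ∈ K, σ ⊆ s → s ⊆ σ ∪ τ
  mem : ∀ s, σ ⊆ s → s ⊆ σ ∪ τ → ¬τ ⊆ s → s ∈ K

lemma IsFlippable.nonempty_homeomorph {σ τ : Finset V} {K : Set (Finset V)}
    (h : IsFlippable σ τ K) : Nonempty (realization K ≃ₜ realization (bistellarFlip σ τ K)) := by
  refine nonempty_homeomorph_of_flipsTo (σ := σ) (τ := τ) ?_ ?_ h.nonempty_left h.nonempty_right
    h.disjoint
  · exact ⟨h.not_subset, h.star, fun s hs hσ => Or.inl ⟨hs, hσ⟩,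
      fun s h1 h2 h3 => Or.inr ⟨h1, h2, h3⟩⟩
  · refine ⟨?_, ?_, ?_, ?_⟩
    · rintro s (hs | hs)
      exacts [hs.2, hs.2.2]
    · rintro s (hs | hs) hτ
      · exact absurd hτ (h.not_subset s hs.1)
      · rw [Finset.union_comm]
        exact hs.2.1
    · rintro s (hs | hs) hτ
      exacts [hs.1, absurd hs.1 hτ]
    · intro s h1 h2 h3
      exact h.mem s h1 (by rwa [Finset.union_comm]) h3

lemma IsFlippable.isThreePseudomanifold {σ τ : Finset V} {K : Set (Finset V)}
    (h : IsFlippable σ τ K) (hK : IsThreePseudomanifold K) :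
    IsThreePseudomanifold (bistellarFlip σ τ K) := by
  refine ⟨?_, ?_, ?_⟩
  · rintro s t hts (⟨hs, hσ⟩ | ⟨hτ, hu, hσ⟩)
    · exact Or.inl ⟨hK.lower hts hs, fun h' => hσ (h'.trans hts)⟩
    · have hts : t ⊆ s := hts
      have hσt : ¬σ ⊆ t := fun h' => hσ (h'.trans hts)
      by_cases hτt : τ ⊆ t
      · exact Or.inr ⟨hτt, hts.trans hu, hσt⟩
      · refine Or.inl ⟨hK.lower (Finset.subset_union_left : t ⊆ t ∪ σ)
          (h.mem _ Finset.subset_union_right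
            (Finset.union_subset (hts.trans hu) Finset.subset_union_left) fun h' => hτt ?_), hσt⟩
        intro i hi
        exact (Finset.mem_union.1 (h' hi)).resolve_right (Finset.disjoint_right.1 h.disjoint hi)
  · rintro s (hs | ⟨-, hu, hσ⟩)
    · exact hK.card_le s hs.1
    · have := Finset.card_lt_card (Finset.ssubset_iff_subset_ne.2
        ⟨hu, fun he => hσ (he ▸ Finset.subset_union_left)⟩)
      have := h.card_union
      omega
  · intro t ht
    have hτt : ∀ a b c : V, a ∉ t → b ∉ t → c ∉ t → a ≠ b → a ≠ c → b ≠ c →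
        insert a t ∈ bistellarFlip σ τ K → insert b t ∈ bistellarFlip σ τ K →
        insert c t ∈ bistellarFlip σ τ K →
        ¬τ ⊆ t := by
      intro a b c ha hb hc hab hac hbc h1 h2 h3 hτ
      have hsub : ∀ x, insert x t ∈ bistellarFlip σ τ K → insert x t ⊆ σ ∪ τ := by
        rintro x (hx | hx)
        · exact absurd (hτ.trans (Finset.subset_insert x t)) (h.not_subset _ hx.1)
        · exact hx.2.1
      have := Finset.card_le_card (show insert a (insert b (insert c t)) ⊆ σ ∪ τ by
        have := hsub a h1; have := hsub b h2; have := hsub c h3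
        grind)
      rw [Finset.card_insert_of_notMem (by grind), Finset.card_insert_of_notMem (by grind),
        Finset.card_insert_of_notMem hc, h.card_union] at this
      omega
    have key : ∀ a b c : V, a ∉ t → b ∉ t → c ∉ t → a ≠ b → a ≠ c → b ≠ c →
        insert a t ∈ bistellarFlip σ τ K → insert b t ∈ bistellarFlip σ τ K →
        insert c t ∈ bistellarFlip σ τ K →
        ¬τ ⊆ insert a t := by
      intro a b c ha hb hc hab hac hbc h1 h2 h3 hτ
      have hτ' := hτt a b c ha hb hc hab hac hbc h1 h2 h3
      have haτ : a ∈ τ := by grind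
      have hb' : insert b t ∈ K ∧ ¬σ ⊆ insert b t := by
        rcases h2 with h2 | h2
        · exact h2
        · have := h2.1; grind
      have hc' : insert c t ∈ K ∧ ¬σ ⊆ insert c t := by
        rcases h3 with h3 | h3
        · exact h3
        · have := h3.1; grind
      have hat : insert a t ⊆ σ ∪ τ := by
        rcases h1 with h1 | h1
        · exact absurd hτ (h.not_subset _ h1.1)
        · exact h1.2.1
      have hcard : ((σ ∪ τ) \ insert a t).card = 1 := by
        rw [Finset.card_sdiff_of_subset hat, h.card_union, Finset.card_insert_of_notMem ha, ht]
      obtain ⟨x, hx⟩ := Finset.card_eq_one.1 hcard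
      have hx' : ∀ y, y ∈ σ ∪ τ → y ∉ insert a t → y = x := fun y h1 h2 =>
        Finset.mem_singleton.1 (hx ▸ Finset.mem_sdiff.2 ⟨h1, h2⟩)
      have hxm : x ∈ σ ∪ τ ∧ x ∉ insert a t :=
        Finset.mem_sdiff.1 (hx ▸ Finset.mem_singleton_self x)
      have haσ : a ∉ σ := Finset.disjoint_right.1 h.disjoint haτ
      have hσx : σ ⊆ insert x t := by
        intro i hi
        by_cases hit : i ∈ t
        · exact Finset.mem_insert_of_mem hit
        · rw [hx' i (Finset.mem_union_left _ hi) (by grind)]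
          exact Finset.mem_insert_self _ _
      have hxK : insert x t ∈ K := h.mem _ hσx (by grind) fun h' => by
        have := h' haτ
        grind
      exact hK.not_three t ht x b c (by grind) hb hc (by grind) (by grind) hbc hxK hb'.1 hc'.1
    intro a b c ha hb hc hab hac hbc h1 h2 h3
    have k1 := key a b c ha hb hc hab hac hbc h1 h2 h3
    have k2 := key b a c hb ha hc hab.symm hbc hac h2 h1 h3
    have k3 := key c a b hc ha hb hac.symm hbc.symm hab h3 h1 h2
    refine hK.not_three t ht a b c ha hb hc hab hac hbc ?_ ?_ ?_
    · exact (h1.resolve_right fun h => k1 h.1).1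
    · exact (h2.resolve_right fun h => k2 h.1).1
    · exact (h3.resolve_right fun h => k3 h.1).1

/-- The boundary of the ball with tetrahedra `B` whose minimal interior faces are in `S`. -/
def ballBoundary (B S : Set (Finset V)) : Set (Finset V) :=
  {s | (∃ T ∈ B, s ⊆ T) ∧ ∀ σ ∈ S, ¬σ ⊆ s}

/-- The complex obtained from `K` by replacing the ball with tetrahedra `B` and interior faces `S`
by the cone with apex `v` over its boundary. -/
def coneOff (v : V) (K B S : Set (Finset V)) : Set (Finset V) :=
  {s | (s ∈ K ∧ ∀ σ ∈ S, ¬σ ⊆ s) ∨ (v ∈ s ∧ s.erase v ∈ ballBoundary B S)}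

/-- `IsStacked B S`: the tetrahedra in `B` form a stacked 3-ball, each interior face of which
contains an element of `S`. -/
inductive IsStacked : Set (Finset V) → Set (Finset V) → Prop
  | single (T : Finset V) : T.card = 4 → IsStacked {T} {T}
  | glue (B S : Set (Finset V)) (σ : Finset V) (w : V) : IsStacked B S → σ.card = 3 →
      σ ∈ ballBoundary B S → (∀ T ∈ B, w ∉ T) → IsStacked (insert (insert w σ) B) (insert σ S)

lemma IsStacked.exists_subset {B S : Set (Finset V)} (h : IsStacked B S) :
    ∀ σ ∈ S, ∃ T ∈ B, σ ⊆ T := by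
  induction h with
  | single T hT => simp
  | glue B S σ w h hσ hm hw ih =>
    rintro ρ (rfl | hρ)
    · exact ⟨_, Or.inl rfl, Finset.subset_insert _ _⟩
    · obtain ⟨T, hT, h⟩ := ih ρ hρ
      exact ⟨T, Or.inr hT, h⟩

lemma IsStacked.two_lt_card {B S : Set (Finset V)} (h : IsStacked B S) :
    ∀ σ ∈ S, 2 < σ.card := by
  induction h with
  | single T hT => simp [hT]
  | glue B S σ w h hσ hm hw ih =>
    rintro ρ (rfl | hρ)
    · omega
    · exact ih ρ hρ

lemma IsThreePseudomanifold.isFlippable_triangle {K : Set (Finset V)}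
    (hK : IsThreePseudomanifold K) {σ : Finset V} (hσ : σ.card = 3) {v w : V} (hvw : v ≠ w)
    (hv : v ∉ σ) (hw : w ∉ σ) (h1 : insert v σ ∈ K) (h2 : insert w σ ∈ K)
    (h3 : {v, w} ∉ K) : IsFlippable σ {v, w} K where
  nonempty_left := Finset.card_pos.1 (by omega)
  nonempty_right := ⟨v, by simp⟩
  disjoint := by simp [hv, hw]
  card_union := by
    rw [Finset.card_union_of_disjoint (by simp [hv, hw]), hσ, Finset.card_pair hvw]
  not_subset := fun s hs hsub => h3 (hK.lower hsub hs)
  star := by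
    intro s hs hsub x hx
    by_contra hx'
    have hxσ : x ∉ σ := by grind
    exact hK.not_three σ hσ v w x hv hw hxσ hvw (by grind) (by grind) h1 h2
      (hK.lower (Finset.insert_subset hx hsub) hs)
  mem := by
    intro s _ hsub hnot
    by_cases hvs : v ∈ s
    · exact hK.lower (show s ⊆ insert v σ by grind) h1
    · exact hK.lower (show s ⊆ insert w σ by grind) h2

/-- Replacing a stacked ball by the cone over its boundary is a composition of flips. -/
lemma IsStacked.coneOff_spec {B S K : Set (Finset V)} (h : IsStacked B S) {v : V}
    (hK : IsThreePseudomanifold K) (hv : ∀ s ∈ K, v ∉ s) (hB : B ⊆ K) :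
    IsThreePseudomanifold (coneOff v K B S) ∧
      Nonempty (realization K ≃ₜ realization (coneOff v K B S)) := by
  induction h with
  | single T hT =>
    have hTK : T ∈ K := hB rfl
    have hvT := hv T hTK
    have hflip : IsFlippable T {v} K :=
      { nonempty_left := Finset.card_pos.1 (by omega)
        nonempty_right := ⟨v, by simp⟩
        disjoint := by simpa using hvT
        card_union := by
          rw [Finset.card_union_of_disjoint (by simpa using hvT), hT, Finset.card_singleton]
        not_subset := by simpa using hv
        star := fun s hs hsub => by
          rw [Finset.eq_of_subset_of_card_le hsub (hT ▸ hK.card_le s hs)]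
          exact Finset.subset_union_left
        mem := fun s h1 h2 h3 => by
          have : s = T := Finset.Subset.antisymm (by grind) h1
          exact this ▸ hTK }
    have heq : bistellarFlip T {v} K = coneOff v K {T} {T} := by
      ext s
      simp only [bistellarFlip, coneOff, ballBoundary, mem_ofPred_eq, mem_singleton_iff, forall_eq,
        exists_eq_left, Finset.singleton_subset_iff]
      have e1 : s ⊆ T ∪ {v} ↔ s.erase v ⊆ T := by grind
      have e2 : T ⊆ s.erase v ↔ T ⊆ s := by grind
      rw [e1, e2]
    exact heq ▸ ⟨hflip.isThreePseudomanifold hK, hflip.nonempty_homeomorph⟩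
  | glue B S σ w h hσ hm hw ih =>
    obtain ⟨hpm, ⟨e⟩⟩ := ih ((subset_insert _ _).trans hB)
    have hwK : insert w σ ∈ K := hB (mem_insert _ _)
    have hBv : ∀ T ∈ B, v ∉ T := fun T hT => hv T (hB (Or.inr hT))
    obtain ⟨T₀, hT₀, hσT₀⟩ := hm.1
    have hvσ : v ∉ σ := fun h => hBv T₀ hT₀ (hσT₀ h)
    have hwσ : w ∉ σ := fun h => hw T₀ hT₀ (hσT₀ h)
    have hvw : v ≠ w := fun h => hv _ hwK (h ▸ Finset.mem_insert_self _ _)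
    have hwS : ∀ ρ ∈ S, w ∉ ρ := fun ρ hρ hwρ => by
      obtain ⟨T, hT, hsub⟩ := h.exists_subset ρ hρ
      exact hw T hT (hsub hwρ)
    have hvS : ∀ ρ ∈ S, v ∉ ρ := fun ρ hρ hvρ => by
      obtain ⟨T, hT, hsub⟩ := h.exists_subset ρ hρ
      exact hBv T hT (hsub hvρ)
    have hσw : ∀ s ⊆ insert w σ, ∀ ρ ∈ S, ¬ρ ⊆ s := fun s hs ρ hρ hsub =>
      hm.2 ρ hρ (by have := hwS ρ hρ; grind)
    have hflip : IsFlippable σ {v, w} (coneOff v K B S) := by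
      refine hpm.isFlippable_triangle hσ hvw hvσ hwσ ?_ ?_ ?_
      · refine Or.inr ⟨Finset.mem_insert_self _ _, ?_⟩
        rwa [Finset.erase_insert hvσ]
      · exact Or.inl ⟨hwK, hσw _ subset_rfl⟩
      · rintro (h | ⟨-, ⟨T, hT, hsub⟩, -⟩)
        · exact hv _ h.1 (by simp)
        · exact hw T hT (hsub (by grind))
    have heq : bistellarFlip σ {v, w} (coneOff v K B S) =
        coneOff v K (insert (insert w σ) B) (insert σ S) := by
      ext s
      have hS : (∀ ρ ∈ insert σ S, ¬ρ ⊆ s) ↔ ¬σ ⊆ s ∧ ∀ ρ ∈ S, ¬ρ ⊆ s := by simp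
      have hS' : (∀ ρ ∈ insert σ S, ¬ρ ⊆ s.erase v) ↔ ¬σ ⊆ s ∧ ∀ ρ ∈ S, ¬ρ ⊆ s := by
        rw [← hS]
        refine forall₂_congr fun ρ hρ => not_congr ?_
        have : v ∉ ρ := by rcases hρ with rfl | hρ; exacts [hvσ, hvS ρ hρ]
        grind
      have hS'' : (∀ ρ ∈ S, ¬ρ ⊆ s.erase v) ↔ ∀ ρ ∈ S, ¬ρ ⊆ s := by
        refine forall₂_congr fun ρ hρ => not_congr ?_
        have := hvS ρ hρ
        grind
      simp only [bistellarFlip, coneOff, ballBoundary, mem_ofPred_eq, hS, hS', hS'',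
        exists_mem_insert]
      constructor
      · rintro (⟨(⟨h1, h2⟩ | ⟨h1, h2, h3⟩), h4⟩ | ⟨h1, h2, h3⟩)
        · exact Or.inl ⟨h1, h4, h2⟩
        · exact Or.inr ⟨h1, Or.inr h2, h4, h3⟩
        · have hsub : s.erase v ⊆ insert w σ := by grind
          exact Or.inr ⟨h1 (by simp), Or.inl hsub, h3, hS''.1 (hσw _ hsub)⟩
      · rintro (⟨h1, h2, h3⟩ | ⟨h1, (h2 | h2), h3, h4⟩)
        · exact Or.inl ⟨Or.inl ⟨h1, h3⟩, h2⟩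
        · by_cases hws : w ∈ s
          · exact Or.inr ⟨by grind, by grind, h3⟩
          · exact Or.inl ⟨Or.inr ⟨h1, ⟨T₀, hT₀, by grind⟩, h4⟩, h3⟩
        · exact Or.inl ⟨Or.inr ⟨h1, h2, h4⟩, h3⟩
    obtain ⟨e'⟩ := hflip.nonempty_homeomorph
    exact heq ▸ ⟨hflip.isThreePseudomanifold hpm, ⟨e.trans e'⟩⟩

end Stacked

/-! ### The inductive construction -/

section Construction

open Pointwise

lemma ballBoundary_neg {B S : Set (Finset ℤ)} {s : Finset ℤ} :
    s ∈ ballBoundary {T | -T ∈ B} {σ | -σ ∈ S} ↔ -s ∈ ballBoundary B S := by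
  have hsub : ∀ a b : Finset ℤ, -a ⊆ -b ↔ a ⊆ b := fun a b =>
    ⟨fun h => by simpa using Finset.neg_subset_neg h, fun h => Finset.neg_subset_neg h⟩
  constructor
  · rintro ⟨⟨T, hT, h1⟩, h2⟩
    exact ⟨⟨-T, hT, (hsub _ _).2 h1⟩, fun σ hσ h3 => h2 (-σ) (by simpa using hσ) (by
      rwa [← hsub, neg_neg])⟩
  · rintro ⟨⟨T, hT, h1⟩, h2⟩
    exact ⟨⟨-T, by simpa using hT, by rwa [← hsub, neg_neg]⟩,
      fun σ hσ h3 => h2 (-σ) hσ ((hsub _ _).2 h3)⟩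

lemma IsStacked.neg {B S : Set (Finset ℤ)} (h : IsStacked B S) :
    IsStacked {T | -T ∈ B} {σ | -σ ∈ S} := by
  induction h with
  | single T hT =>
    have : {s : Finset ℤ | -s ∈ ({T} : Set (Finset ℤ))} = {-T} := by
      ext s; simp [neg_eq_iff_eq_neg]
    rw [this]
    exact .single _ (by simpa using hT)
  | glue B S σ w h hσ hm hw ih =>
    have h1 : {T : Finset ℤ | -T ∈ insert (insert w σ) B} =
        insert (insert (-w) (-σ)) {T | -T ∈ B} := by
      ext s
      have : -insert w σ = insert (-w) (-σ) := by ext; simp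
      simp only [mem_insert_iff, mem_ofPred_eq, neg_eq_iff_eq_neg, this]
    have h2 : {ρ : Finset ℤ | -ρ ∈ insert σ S} = insert (-σ) {ρ | -ρ ∈ S} := by
      ext s
      simp [neg_eq_iff_eq_neg]
    rw [h1, h2]
    refine .glue _ _ _ _ ih (by simpa using hσ) (ballBoundary_neg.2 (by simpa using hm)) ?_
    intro T hT hwT
    exact hw _ hT (by simpa using hwT)

/-- The join of a path `p 0, …, p k` with an edge `{a, b}` is a stacked ball. -/
lemma isStacked_path_join {p : ℕ → ℤ} {a b : ℤ} (hab : a ≠ b) {k : ℕ} (hk : 1 ≤ k)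
    (hp : ∀ i ≤ k, ∀ j ≤ k, p i = p j → i = j) (hpa : ∀ i ≤ k, p i ≠ a)
    (hpb : ∀ i ≤ k, p i ≠ b) :
    IsStacked {T | ∃ i < k, T = {p i, p (i + 1), a, b}}
      {σ | (∃ i, 1 ≤ i ∧ i < k ∧ σ = {p i, a, b}) ∨ σ = {p 0, p 1, a, b}} := by
  induction k, hk using Nat.le_induction with
  | base =>
    have h1 : {T : Finset ℤ | ∃ i < 1, T = {p i, p (i + 1), a, b}} = {{p 0, p 1, a, b}} := by
      ext T; simp
    have h2 : {σ : Finset ℤ | (∃ i, 1 ≤ i ∧ i < 1 ∧ σ = {p i, a, b}) ∨ σ = {p 0, p 1, a, b}} =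
        {{p 0, p 1, a, b}} := by
      ext T
      simp only [mem_ofPred_eq, mem_singleton_iff, or_iff_right_iff_imp]
      rintro ⟨i, h1, h2, -⟩
      omega
    rw [h1, h2]
    have h01 : p 0 ≠ p 1 := fun h => by simpa using hp 0 (by omega) 1 (by omega) h
    refine .single _ ?_
    have := hpa 0 (by omega)
    have := hpb 0 (by omega)
    have := hpa 1 le_rfl
    have := hpb 1 le_rfl
    rw [Finset.card_insert_of_notMem (by grind), Finset.card_eq_three.2
      ⟨_, _, _, by assumption, by assumption, hab, rfl⟩]
  | succ k hk ih =>
    have ih := ih (fun i hi j hj => hp i (by omega) j (by omega)) (fun i hi => hpa i (by omega))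
      (fun i hi => hpb i (by omega))
    have hne : ∀ i < k + 1, p i ≠ p (k + 1) := fun i hi h => by
      have := hp i (by omega) (k + 1) le_rfl h
      omega
    have hnk : ∀ i < k, p i ≠ p k := fun i hi h => by
      have := hp i (by omega) k (by omega) h
      omega
    have ha := hpa k (by omega)
    have hb := hpb k (by omega)
    have ha' := hpa (k + 1) le_rfl
    have hb' := hpb (k + 1) le_rfl
    convert IsStacked.glue _ _ {p k, a, b} (p (k + 1)) ih ?_ ⟨?_, ?_⟩ ?_ using 1
    · ext T
      simp only [mem_ofPred_eq, mem_insert_iff]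
      constructor
      · rintro ⟨i, hi, rfl⟩
        rcases Nat.lt_succ_iff_lt_or_eq.1 hi with h | rfl
        · exact Or.inr ⟨i, h, rfl⟩
        · left; grind
      · rintro (rfl | ⟨i, hi, rfl⟩)
        · exact ⟨k, by omega, by grind⟩
        · exact ⟨i, by omega, rfl⟩
    · ext σ
      simp only [mem_ofPred_eq, mem_insert_iff]
      constructor
      · rintro (⟨i, h1, h2, rfl⟩ | h)
        · rcases Nat.lt_succ_iff_lt_or_eq.1 h2 with h | rfl
          · exact Or.inr (Or.inl ⟨i, h1, h, rfl⟩)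
          · exact Or.inl rfl
        · exact Or.inr (Or.inr h)
      · rintro (rfl | ⟨i, h1, h2, rfl⟩ | h)
        · exact Or.inl ⟨k, hk, by omega, rfl⟩
        · exact Or.inl ⟨i, h1, by omega, rfl⟩
        · exact Or.inr h
    · grind
    · refine ⟨_, ⟨k - 1, by omega, rfl⟩, ?_⟩
      rw [Nat.sub_add_cancel hk]
      grind
    · rintro σ (⟨i, h1, h2, rfl⟩ | rfl) hsub
      · have := hsub (Finset.mem_insert_self _ _)
        have := hnk i h2
        have := hpa i (by omega)
        have := hpb i (by omega)
        grind
      · have := hsub (Finset.mem_insert_self _ _)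
        have := hnk 0 (by omega)
        have := hpa 0 (by omega)
        have := hpb 0 (by omega)
        grind
    · rintro T ⟨i, hi, rfl⟩
      have := hne i (by omega)
      have := hne (i + 1) (by omega)
      grind

/-- Consecutive vertices of the path `-1, …, -m, 1, …, m`. -/
def PathEdge (m x y : ℤ) : Prop :=
  (-m < x ∧ x ≤ -1 ∧ y = x - 1) ∨ (x = -m ∧ y = 1) ∨ (1 ≤ x ∧ x < m ∧ y = x + 1)

/-- Interior vertices of the path `-1, …, -m, 1, …, m`. -/
def PathInterior (m x : ℤ) : Prop :=
  (-m ≤ x ∧ x < -1) ∨ (1 ≤ x ∧ x < m)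

/-- The tetrahedra of a stacked ball on the vertices `±1, …, ±(m + 2)`. -/
def tetrahedra (m : ℤ) : Set (Finset ℤ) :=
  {T | (∃ x y, PathEdge m x y ∧ T = {x, y, m + 1, m + 2}) ∨ T = {-m, 1, -(m + 1), m + 2} ∨
    T = {-m, 1, -(m + 1), -(m + 2)}}

/-- Faces generating the interior of the ball with tetrahedra `tetrahedra m`. -/
def walls (m : ℤ) : Set (Finset ℤ) :=
  {σ | (∃ x, PathInterior m x ∧ σ = {x, m + 1, m + 2}) ∨ σ = {-m, 1, m + 2} ∨
    σ = {-m, 1, -(m + 1)} ∨ σ = {-1, -2, m + 1, m + 2}}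

lemma isStacked_tetrahedra {m : ℤ} (hm : 2 ≤ m) : IsStacked (tetrahedra m) (walls m) := by
  have h := isStacked_path_join (p := fun i => if (i : ℤ) < m then -(i + 1) else i - m + 1)
    (a := m + 1) (b := m + 2) (k := (2 * m - 1).toNat) (by omega) (by omega)
    (by intro i hi j hj; split_ifs <;> omega)
    (by intro i hi; split_ifs <;> omega)
    (by intro i hi; split_ifs <;> omega)
  have e1 : {T : Finset ℤ | ∃ i < (2 * m - 1).toNat, T =
      {(fun i : ℕ => if (i : ℤ) < m then -((i : ℤ) + 1) else i - m + 1) i,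
        (fun i : ℕ => if (i : ℤ) < m then -((i : ℤ) + 1) else i - m + 1) (i + 1),
        m + 1, m + 2}} = {T | ∃ x y, PathEdge m x y ∧ T = {x, y, m + 1, m + 2}} := by
    ext T
    constructor
    · rintro ⟨i, hi, rfl⟩
      refine ⟨_, _, ?_, rfl⟩
      unfold PathEdge
      dsimp only
      split_ifs <;> omega
    · rintro ⟨x, y, hxy, rfl⟩
      unfold PathEdge at hxy
      refine ⟨if x < 0 then (-x - 1).toNat else (x + m - 1).toNat, ?_, ?_⟩
      · split_ifs <;> omega
      · dsimp only
        congr 2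
        · split_ifs <;> omega
        · split_ifs <;> omega
  have e2 : {σ : Finset ℤ | (∃ i, 1 ≤ i ∧ i < (2 * m - 1).toNat ∧ σ =
      {(fun i : ℕ => if (i : ℤ) < m then -((i : ℤ) + 1) else i - m + 1) i, m + 1, m + 2}) ∨
      σ = {(fun i : ℕ => if (i : ℤ) < m then -((i : ℤ) + 1) else i - m + 1) 0,
        (fun i : ℕ => if (i : ℤ) < m then -((i : ℤ) + 1) else i - m + 1) 1, m + 1, m + 2}} =
      {σ | (∃ x, PathInterior m x ∧ σ = {x, m + 1, m + 2}) ∨ σ = {-1, -2, m + 1, m + 2}} := by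
    ext σ
    refine or_congr ⟨?_, ?_⟩ ?_
    · rintro ⟨i, h1, h2, rfl⟩
      refine ⟨_, ?_, rfl⟩
      unfold PathInterior
      dsimp only
      split_ifs <;> omega
    · rintro ⟨x, hx, rfl⟩
      unfold PathInterior at hx
      refine ⟨if x < 0 then (-x - 1).toNat else (x + m - 1).toNat, ?_, ?_, ?_⟩
      · split_ifs <;> omega
      · split_ifs <;> omega
      · dsimp only
        congr 1
        split_ifs <;> omega
    · have h0 : (0 : ℤ) < m := by omega
      have h1 : (1 : ℤ) < m := by omega
      simp [h0, h1]
  rw [e1, e2] at h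
  have h' := IsStacked.glue _ _ {-m, 1, m + 2} (-(m + 1)) h
    (Finset.card_eq_three.2 ⟨_, _, _, by omega, by omega, by omega, rfl⟩)
    ⟨⟨_, ⟨-m, 1, by unfold PathEdge; omega, rfl⟩, by grind⟩, ?_⟩ ?_
  · have h'' := IsStacked.glue _ _ {-m, 1, -(m + 1)} (-(m + 2)) h'
      (Finset.card_eq_three.2 ⟨_, _, _, by omega, by omega, by omega, rfl⟩)
      ⟨⟨_, Or.inl rfl, by grind⟩, ?_⟩ ?_
    · convert h'' using 1
      · ext T
        simp only [tetrahedra, mem_ofPred_eq, mem_insert_iff]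
        have e1 : ({-m, 1, -(m + 1), m + 2} : Finset ℤ) = {-(m + 1), -m, 1, m + 2} := by grind
        have e2 : ({-m, 1, -(m + 1), -(m + 2)} : Finset ℤ) = {-(m + 2), -m, 1, -(m + 1)} := by
          grind
        rw [e1, e2]
        rw [iff_iff_eq]
        ac_rfl
      · ext σ
        simp only [walls, mem_ofPred_eq, mem_insert_iff]
        rw [iff_iff_eq]
        ac_rfl
    · rintro σ (rfl | ⟨x, hx, rfl⟩ | rfl) <;>
        simp only [Finset.insert_subset_iff, Finset.singleton_subset_iff, Finset.mem_insert,
          Finset.mem_singleton] <;> omega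
    · rintro T (rfl | ⟨x, y, hxy, rfl⟩) <;> simp only [Finset.mem_insert, Finset.mem_singleton]
      · omega
      · unfold PathEdge at hxy; omega
  · rintro σ (⟨x, hx, rfl⟩ | rfl) <;>
      simp only [Finset.insert_subset_iff, Finset.singleton_subset_iff, Finset.mem_insert,
        Finset.mem_singleton] <;> omega
  · rintro T ⟨x, y, hxy, rfl⟩
    unfold PathEdge at hxy
    simp only [Finset.mem_insert, Finset.mem_singleton]
    omega

lemma not_neg_wall_subset {m : ℤ} (hm : 2 ≤ m) {T σ : Finset ℤ} (hT : T ∈ tetrahedra m)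
    (hσ : σ ∈ walls m) : ¬-σ ⊆ T := by
  intro h
  have h : ∀ z ∈ σ, -z ∈ T := fun z hz => h (by simpa using hz)
  unfold tetrahedra PathEdge at hT
  unfold walls PathInterior at hσ
  rcases hσ with ⟨z, hz, rfl⟩ | rfl | rfl | rfl <;>
  rcases hT with ⟨x, y, hxy, rfl⟩ | rfl | rfl <;>
  simp only [Finset.mem_insert, Finset.mem_singleton, forall_eq_or_imp, forall_eq] at h <;>
  omega

/-- Every nonzero integer of absolute value at most `m + 2` is a vertex of the ball. -/
lemma exists_mem_tetrahedra {m : ℤ} (hm : 2 ≤ m) {x : ℤ} (hx0 : x ≠ 0) (hx1 : -(m + 2) ≤ x)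
    (hx2 : x ≤ m + 2) : ∃ T ∈ tetrahedra m, x ∈ T := by
  by_cases h1 : x = m + 1 ∨ x = m + 2
  · exact ⟨_, Or.inl ⟨-m, 1, by unfold PathEdge; omega, rfl⟩, by grind⟩
  by_cases h2 : x = -(m + 1) ∨ x = -(m + 2) ∨ x = 1
  · exact ⟨_, Or.inr (Or.inr rfl), by grind⟩
  by_cases h3 : x = -1
  · exact ⟨_, Or.inl ⟨-1, -2, by unfold PathEdge; omega, rfl⟩, by grind⟩
  · refine ⟨_, Or.inl ⟨if x < 0 then x + 1 else x - 1, x, ?_, rfl⟩, by grind⟩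
    unfold PathEdge
    split_ifs <;> omega

/-- The invariants of the construction: `K` is a centrally symmetric triangulated 3-sphere on the
vertices `±1, …, ±(m + 2)` with all non-antipodal edges, containing the stacked ball
`tetrahedra m`. -/
structure IsNeighborlySphere (m : ℤ) (K : Set (Finset ℤ)) : Prop where
  pseudomanifold : IsThreePseudomanifold K
  bounds : ∀ s ∈ K, ∀ x ∈ s, x ≠ 0 ∧ -(m + 2) ≤ x ∧ x ≤ m + 2
  neg_notMem : ∀ s ∈ K, ∀ x ∈ s, -x ∉ s
  neg_mem : ∀ s ∈ K, -s ∈ K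
  edge : ∀ x y : ℤ, x ≠ 0 → y ≠ 0 → -(m + 2) ≤ x → x ≤ m + 2 → -(m + 2) ≤ y → y ≤ m + 2 →
    x ≠ -y → {x, y} ∈ K
  tetrahedra_subset : tetrahedra m ⊆ K
  homeomorph : Nonempty (realization K ≃ₜ Metric.sphere (0 : EuclideanSpace ℝ (Fin 4)) 1)

/-- Two new antipodal vertices are added by coning off the stacked ball and its antipode. -/
def addAntipodalPair (m : ℤ) (K : Set (Finset ℤ)) : Set (Finset ℤ) :=
  coneOff (-(m + 3)) (coneOff (m + 3) K (tetrahedra m) (walls m))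
    {T | -T ∈ tetrahedra m} {σ | -σ ∈ walls m}

lemma mem_ballBoundary_of_subset_tetrahedra_succ {m : ℤ} (hm : 2 ≤ m) {x y : ℤ}
    (hxy : PathEdge (m + 1) x y) : {x, y, m + 2} ∈ ballBoundary (tetrahedra m) (walls m) := by
  unfold PathEdge at hxy
  constructor
  · by_cases h1 : x = -m ∨ x = -(m + 1)
    · exact ⟨_, Or.inr (Or.inl rfl), by grind⟩
    by_cases h2 : x = m
    · exact ⟨_, Or.inl ⟨m - 1, m, by unfold PathEdge; omega, rfl⟩, by grind⟩
    · exact ⟨_, Or.inl ⟨x, y, by unfold PathEdge; omega, rfl⟩, by grind⟩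
  · unfold walls PathInterior
    rintro σ (⟨z, hz, rfl⟩ | rfl | rfl | rfl) <;>
      simp only [Finset.insert_subset_iff, Finset.singleton_subset_iff, Finset.mem_insert,
        Finset.mem_singleton] <;> omega

lemma mem_ballBoundary_of_pos {m : ℤ} (hm : 2 ≤ m) {s : Finset ℤ}
    (hs : s = {-(m + 1), 1, -(m + 2)} ∨ s = {-1, m + 1, m + 2}) :
    s ∈ ballBoundary (tetrahedra m) (walls m) := by
  constructor
  · rcases hs with rfl | rfl
    · exact ⟨_, Or.inr (Or.inr rfl), by grind⟩
    · exact ⟨_, Or.inl ⟨-1, -2, by unfold PathEdge; omega, rfl⟩, by grind⟩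
  · unfold walls PathInterior
    rcases hs with rfl | rfl <;> rintro σ (⟨z, hz, rfl⟩ | rfl | rfl | rfl) <;>
      simp only [Finset.insert_subset_iff, Finset.singleton_subset_iff, Finset.mem_insert,
        Finset.mem_singleton] <;> omega

lemma IsNeighborlySphere.ballBoundary_subset {m : ℤ} {K : Set (Finset ℤ)}
    (hK : IsNeighborlySphere m K) : ballBoundary (tetrahedra m) (walls m) ⊆ K := by
  rintro s ⟨⟨T, hT, hs⟩, -⟩
  exact hK.pseudomanifold.lower hs (hK.tetrahedra_subset hT)

lemma IsNeighborlySphere.apex_notMem {m : ℤ} {K : Set (Finset ℤ)}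
    (hK : IsNeighborlySphere m K) {s : Finset ℤ} (hs : s ∈ K) : m + 3 ∉ s := fun h => by
  have := hK.bounds s hs _ h
  omega

lemma IsNeighborlySphere.neg_apex_notMem {m : ℤ} {K : Set (Finset ℤ)}
    (hK : IsNeighborlySphere m K) {s : Finset ℤ} (hs : s ∈ K) : -(m + 3) ∉ s := fun h => by
  have := hK.bounds s hs _ h
  omega

lemma IsNeighborlySphere.mem_addAntipodalPair {m : ℤ} (hm : 2 ≤ m) {K : Set (Finset ℤ)}
    (hK : IsNeighborlySphere m K) (s : Finset ℤ) : s ∈ addAntipodalPair m K ↔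
      (s ∈ K ∧ (∀ σ ∈ walls m, ¬σ ⊆ s) ∧ ∀ σ, -σ ∈ walls m → ¬σ ⊆ s) ∨
      (m + 3 ∈ s ∧ s.erase (m + 3) ∈ ballBoundary (tetrahedra m) (walls m)) ∨
      (-(m + 3) ∈ s ∧ -(s.erase (-(m + 3))) ∈ ballBoundary (tetrahedra m) (walls m)) := by
  have hwv : ∀ σ ∈ walls m, -(m + 3) ∉ σ := fun σ hσ => by
    obtain ⟨T, hT, hs⟩ := (isStacked_tetrahedra hm).exists_subset σ hσ
    exact fun h => hK.neg_apex_notMem (hK.tetrahedra_subset hT) (hs h)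
  have havoid : s.erase (m + 3) ∈ ballBoundary (tetrahedra m) (walls m) →
      ∀ σ, -σ ∈ walls m → ¬σ ⊆ s := by
    rintro ⟨⟨T, hT, hs⟩, -⟩ σ hσ hsub
    refine not_neg_wall_subset hm hT hσ ?_
    rw [neg_neg]
    intro x hx
    refine hs (Finset.mem_erase.2 ⟨?_, hsub hx⟩)
    rintro rfl
    exact hwv _ hσ (by simpa using hx)
  have : s ∈ addAntipodalPair m K ↔
      (((s ∈ K ∧ ∀ σ ∈ walls m, ¬σ ⊆ s) ∨
        (m + 3 ∈ s ∧ s.erase (m + 3) ∈ ballBoundary (tetrahedra m) (walls m))) ∧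
        ∀ σ, -σ ∈ walls m → ¬σ ⊆ s) ∨
      (-(m + 3) ∈ s ∧ s.erase (-(m + 3)) ∈
        ballBoundary {T | -T ∈ tetrahedra m} {σ | -σ ∈ walls m}) := Iff.rfl
  rw [this, ballBoundary_neg]
  tauto

lemma IsNeighborlySphere.neg_mem_addAntipodalPair {m : ℤ} (hm : 2 ≤ m) {K : Set (Finset ℤ)}
    (hK : IsNeighborlySphere m K) {s : Finset ℤ} (hs : s ∈ addAntipodalPair m K) :
    -s ∈ addAntipodalPair m K := by
  have herase : ∀ v : ℤ, (-s).erase v = -(s.erase (-v)) := by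
    intro v
    ext x
    simp [neg_eq_iff_eq_neg]
  rw [hK.mem_addAntipodalPair hm] at hs ⊢
  rcases hs with ⟨h1, h2, h3⟩ | ⟨h1, h2⟩ | ⟨h1, h2⟩
  · refine Or.inl ⟨hK.neg_mem s h1, fun σ hσ hsub => h3 (-σ) (by simpa using hσ) ?_,
      fun σ hσ hsub => h2 _ hσ ?_⟩ <;> simpa using Finset.neg_subset_neg hsub
  · refine Or.inr (Or.inr ⟨by simpa using h1, ?_⟩)
    rw [herase]
    simpa using h2
  · refine Or.inr (Or.inl ⟨by simpa using h1, ?_⟩)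
    rw [herase]
    exact h2

lemma IsNeighborlySphere.insert_mem_addAntipodalPair {m : ℤ} (hm : 2 ≤ m) {K : Set (Finset ℤ)}
    (hK : IsNeighborlySphere m K) {s : Finset ℤ}
    (hs : s ∈ ballBoundary (tetrahedra m) (walls m)) :
    insert (m + 3) s ∈ addAntipodalPair m K :=
  (hK.mem_addAntipodalPair hm _).2 (Or.inr (Or.inl ⟨Finset.mem_insert_self _ _, by
    rwa [Finset.erase_insert (hK.apex_notMem (hK.ballBoundary_subset hs))]⟩))

lemma IsNeighborlySphere.addAntipodalPair_cases {m : ℤ} (hm : 2 ≤ m) {K : Set (Finset ℤ)}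
    (hK : IsNeighborlySphere m K) {s : Finset ℤ} (hs : s ∈ addAntipodalPair m K) :
    s ∈ K ∨ (m + 3 ∈ s ∧ s.erase (m + 3) ∈ K) ∨ (-(m + 3) ∈ s ∧ s.erase (-(m + 3)) ∈ K) := by
  rcases (hK.mem_addAntipodalPair hm s).1 hs with h | h | h
  · exact Or.inl h.1
  · exact Or.inr (Or.inl ⟨h.1, hK.ballBoundary_subset h.2⟩)
  · exact Or.inr (Or.inr ⟨h.1, by simpa using hK.neg_mem _ (hK.ballBoundary_subset h.2)⟩)

lemma IsNeighborlySphere.addAntipodalPair_spec {m : ℤ} (hm : 2 ≤ m) {K : Set (Finset ℤ)}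
    (hK : IsNeighborlySphere m K) : IsThreePseudomanifold (addAntipodalPair m K) ∧
      Nonempty (realization K ≃ₜ realization (addAntipodalPair m K)) := by
  have hst := isStacked_tetrahedra hm
  obtain ⟨hp1, ⟨e1⟩⟩ := hst.coneOff_spec hK.pseudomanifold (fun s hs => hK.apex_notMem hs)
    hK.tetrahedra_subset
  obtain ⟨hp2, ⟨e2⟩⟩ := hst.neg.coneOff_spec hp1 (v := -(m + 3)) (by
      rintro s (⟨hs, -⟩ | ⟨-, hs⟩) hvs
      · exact hK.neg_apex_notMem hs hvs
      · refine hK.neg_apex_notMem (hK.ballBoundary_subset hs) (Finset.mem_erase.2 ⟨?_, hvs⟩)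
        omega) (by
      intro T hT
      refine Or.inl ⟨?_, fun σ hσ hsub => not_neg_wall_subset hm hT hσ (Finset.neg_subset_neg hsub)⟩
      simpa using hK.neg_mem _ (hK.tetrahedra_subset hT))
  exact ⟨hp2, ⟨e1.trans e2⟩⟩

lemma IsNeighborlySphere.edge_addAntipodalPair {m : ℤ} (hm : 2 ≤ m) {K : Set (Finset ℤ)}
    (hK : IsNeighborlySphere m K) {x y : ℤ} (hx0 : x ≠ 0) (hy0 : y ≠ 0) (hx1 : -(m + 3) ≤ x)
    (hx2 : x ≤ m + 3) (hy1 : -(m + 3) ≤ y) (hy2 : y ≤ m + 3) (hxy : x ≠ -y) :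
    {x, y} ∈ addAntipodalPair m K := by
  have hst := isStacked_tetrahedra hm
  have hlt := hst.two_lt_card
  have hedge : ∀ x : ℤ, x ≠ 0 → -(m + 2) ≤ x → x ≤ m + 2 →
      {m + 3, x} ∈ addAntipodalPair m K := by
    intro x h0 h1 h2
    obtain ⟨T, hT, hx⟩ := exists_mem_tetrahedra hm h0 h1 h2
    refine hK.insert_mem_addAntipodalPair hm
      ⟨⟨T, hT, by simpa using hx⟩, fun σ hσ hsub => ?_⟩
    have h1 := Finset.card_le_card hsub
    have h2 := hlt σ hσ
    rw [Finset.card_singleton] at h1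
    omega
  have hedge' : ∀ x : ℤ, x ≠ 0 → -(m + 2) ≤ x → x ≤ m + 2 →
      {-(m + 3), x} ∈ addAntipodalPair m K := by
    intro x h0 h1 h2
    have := hK.neg_mem_addAntipodalPair hm (hedge (-x) (by omega) (by omega) (by omega))
    have hpair : -({m + 3, -x} : Finset ℤ) = {-(m + 3), x} := by ext; simp
    rwa [hpair] at this
  by_cases hx : x = m + 3 ∨ x = -(m + 3)
  · by_cases hy : y = m + 3 ∨ y = -(m + 3)
    · have h1 : ({x, y} : Finset ℤ) ⊆ {x, 1} := by
        have : y = x := by omega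
        simp [this]
      refine (hK.addAntipodalPair_spec hm).1.lower h1 ?_
      rcases hx with rfl | rfl
      · exact hedge 1 (by omega) (by omega) (by omega)
      · exact hedge' 1 (by omega) (by omega) (by omega)
    · rcases hx with rfl | rfl
      · exact hedge y (by omega) (by omega) (by omega)
      · exact hedge' y (by omega) (by omega) (by omega)
  · by_cases hy : y = m + 3 ∨ y = -(m + 3)
    · rw [Finset.pair_comm]
      rcases hy with rfl | rfl
      · exact hedge x (by omega) (by omega) (by omega)
      · exact hedge' x (by omega) (by omega) (by omega)
    · have hc : ({x, y} : Finset ℤ).card ≤ 2 := Finset.card_le_two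
      refine (hK.mem_addAntipodalPair hm _).2 (Or.inl ⟨hK.edge x y hx0 hy0 (by omega) (by omega)
        (by omega) (by omega) hxy, fun σ hσ hsub => ?_, fun σ hσ hsub => ?_⟩)
      · have := hlt σ hσ
        have := Finset.card_le_card hsub
        omega
      · have h1 := hlt _ hσ
        have := Finset.card_le_card hsub
        rw [Finset.card_neg] at h1
        omega

lemma IsNeighborlySphere.tetrahedra_succ_subset {m : ℤ} (hm : 2 ≤ m) {K : Set (Finset ℤ)}
    (hK : IsNeighborlySphere m K) : tetrahedra (m + 1) ⊆ addAntipodalPair m K := by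
  have e1 : m + 1 + 1 = m + 2 := by ring
  have e2 : m + 1 + 2 = m + 3 := by ring
  have key : ∀ s ∈ ballBoundary (tetrahedra m) (walls m), ∀ T : Finset ℤ,
      T = insert (m + 3) s → T ∈ addAntipodalPair m K := fun s hs T hT =>
    hT ▸ hK.insert_mem_addAntipodalPair hm hs
  rintro T (⟨x, y, hxy, rfl⟩ | rfl | rfl) <;> rw [e1, e2]
  · exact key _ (mem_ballBoundary_of_subset_tetrahedra_succ hm hxy) _ (by grind)
  · exact key _ (mem_ballBoundary_of_pos hm (Or.inl rfl)) _ (by grind)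
  · rw [← neg_neg ({_, _, _, _} : Finset ℤ)]
    refine hK.neg_mem_addAntipodalPair hm (key _ (mem_ballBoundary_of_pos hm (Or.inr rfl)) _ ?_)
    ext
    simp only [Finset.mem_neg', Finset.mem_insert, Finset.mem_singleton]
    omega

lemma IsNeighborlySphere.succ {m : ℤ} (hm : 2 ≤ m) {K : Set (Finset ℤ)}
    (hK : IsNeighborlySphere m K) : IsNeighborlySphere (m + 1) (addAntipodalPair m K) := by
  obtain ⟨hp, ⟨e⟩⟩ := hK.addAntipodalPair_spec hm
  obtain ⟨e'⟩ := hK.homeomorph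
  refine ⟨hp, ?_, ?_, fun s => hK.neg_mem_addAntipodalPair hm, ?_, hK.tetrahedra_succ_subset hm,
    ⟨e.symm.trans e'⟩⟩
  · intro s hs x hx
    by_cases hxv : x = m + 3 ∨ x = -(m + 3)
    · omega
    · have hx1 : x ∈ s.erase (m + 3) := Finset.mem_erase.2 ⟨by tauto, hx⟩
      have hx2 : x ∈ s.erase (-(m + 3)) := Finset.mem_erase.2 ⟨by tauto, hx⟩
      have : x ≠ 0 ∧ -(m + 2) ≤ x ∧ x ≤ m + 2 := by
        rcases hK.addAntipodalPair_cases hm hs with h | ⟨-, h⟩ | ⟨-, h⟩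
        exacts [hK.bounds s h x hx, hK.bounds _ h x hx1, hK.bounds _ h x hx2]
      omega
  · intro s hs x hx hnx
    rcases hK.addAntipodalPair_cases hm hs with h | ⟨-, h⟩ | ⟨-, h⟩
    · exact hK.neg_notMem s h x hx hnx
    · have := hK.neg_apex_notMem h
      have := hK.neg_notMem _ h x
      grind
    · have := hK.apex_notMem h
      have := hK.neg_notMem _ h x
      grind
  · intro x y hx0 hy0 hx1 hx2 hy1 hy2 hxy
    exact hK.edge_addAntipodalPair hm hx0 hy0 (by omega) (by omega) (by omega) (by omega) hxy

end Construction

/-! ### The boundary of the 4-dimensional cross-polytope -/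

section CrossPolytope

open Pointwise

/-- The boundary complex of the cross-polytope with vertices `±1, ±2, ±3, ±4`. -/
def crossPolytopeBoundary : Set (Finset ℤ) :=
  {s | ∀ x ∈ s, x ≠ 0 ∧ -4 ≤ x ∧ x ≤ 4 ∧ -x ∉ s}

lemma mem_realization_crossPolytopeBoundary {x : ℤ → ℝ} :
    x ∈ realization crossPolytopeBoundary ↔ (∀ z, 0 ≤ x z) ∧
      (∀ z, z = 0 ∨ z < -4 ∨ 4 < z → x z = 0) ∧ (∀ z, x z = 0 ∨ x (-z) = 0) ∧
      ∑ i : Fin 4, (x (i + 1) + x (-(i + 1))) = 1 := by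
  have hA : ∑ z ∈ ({1, 2, 3, 4, -1, -2, -3, -4} : Finset ℤ), x z =
      ∑ i : Fin 4, (x (i + 1) + x (-(i + 1))) := by
    simp [Fin.sum_univ_four]
    ring
  constructor
  · intro hx
    obtain ⟨s, hs, hpos, hzero, hsum⟩ := id hx
    refine ⟨nonneg_of_mem_realization hx, fun z hz => hzero z fun h => ?_, fun z => ?_, ?_⟩
    · have := hs z h
      omega
    · by_cases h : z ∈ s
      · exact Or.inr (hzero _ (hs z h).2.2.2)
      · exact Or.inl (hzero z h)
    · rw [← hA, ← hsum]
      refine (Finset.sum_subset (fun z hz => ?_) fun z _ hz => hzero z hz).symm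
      have := hs z hz
      simp only [Finset.mem_insert, Finset.mem_singleton]
      omega
  · rintro ⟨h0, hout, hanti, hsum⟩
    have hin : ∀ z, x z ≠ 0 → z ≠ 0 ∧ -4 ≤ z ∧ z ≤ 4 := by
      intro z hz
      by_contra h
      exact hz (hout z (by omega))
    refine ⟨({1, 2, 3, 4, -1, -2, -3, -4} : Finset ℤ).filter fun z => 0 < x z, ?_, ?_, ?_, ?_⟩
    · intro z hz
      have hz' := (Finset.mem_filter.1 hz).2
      have := hin z hz'.ne'
      refine ⟨this.1, this.2.1, this.2.2, fun h => ?_⟩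
      have := (Finset.mem_filter.1 h).2
      rcases hanti z with h | h <;> linarith
    · exact fun z hz => (Finset.mem_filter.1 hz).2
    · intro z hz
      by_contra h
      refine hz (Finset.mem_filter.2 ⟨?_, lt_of_le_of_ne (h0 z) (Ne.symm h)⟩)
      have := hin z h
      simp only [Finset.mem_insert, Finset.mem_singleton]
      omega
    · rw [Finset.sum_filter_of_ne fun z _ hz => lt_of_le_of_ne (h0 z) (Ne.symm hz), hA, hsum]

/-- The point of `ℝ⁴` with the given barycentric coordinates in the cross-polytope. -/
noncomputable def crossPolytopePoint (x : ℤ → ℝ) : EuclideanSpace ℝ (Fin 4) :=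
  WithLp.toLp 2 fun i => x (i + 1) - x (-(i + 1))

/-- The barycentric coordinates of the radial projection of `y` to the cross-polytope. -/
noncomputable def crossPolytopeCoord (y : EuclideanSpace ℝ (Fin 4)) (z : ℤ) : ℝ :=
  ((∑ i : Fin 4, if z = i + 1 then max (y i) 0 else 0) +
    ∑ i : Fin 4, if z = -(i + 1) then max (-y i) 0 else 0) / ∑ i : Fin 4, |y i|

lemma crossPolytopeCoord_pos (y : EuclideanSpace ℝ (Fin 4)) (j : Fin 4) :
    crossPolytopeCoord y (j + 1) = max (y j) 0 / ∑ i : Fin 4, |y i| := by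
  have h1 : ∀ i : Fin 4, ((j : ℤ) + 1 = i + 1) ↔ j = i := fun i => by omega
  have h2 : ∀ i : Fin 4, ((j : ℤ) + 1 = -(i + 1)) ↔ False := fun i => iff_false_intro (by omega)
  simp only [crossPolytopeCoord, h1, h2]
  simp

lemma crossPolytopeCoord_neg (y : EuclideanSpace ℝ (Fin 4)) (j : Fin 4) :
    crossPolytopeCoord y (-(j + 1)) = max (-y j) 0 / ∑ i : Fin 4, |y i| := by
  have h1 : ∀ i : Fin 4, (-((j : ℤ) + 1) = -(i + 1)) ↔ j = i := fun i => by omega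
  have h2 : ∀ i : Fin 4, (-((j : ℤ) + 1) = i + 1) ↔ False := fun i => iff_false_intro (by omega)
  simp only [crossPolytopeCoord, h1, h2]
  simp

lemma crossPolytopeCoord_zero (y : EuclideanSpace ℝ (Fin 4)) {z : ℤ}
    (hz : z = 0 ∨ z < -4 ∨ 4 < z) : crossPolytopeCoord y z = 0 := by
  have h1 : ∀ i : Fin 4, (z = i + 1) ↔ False := fun i => iff_false_intro (by omega)
  have h2 : ∀ i : Fin 4, (z = -(i + 1)) ↔ False := fun i => iff_false_intro (by omega)
  simp only [crossPolytopeCoord, h1, h2]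
  simp

lemma int_trichotomy (z : ℤ) : (z = 0 ∨ z < -4 ∨ 4 < z) ∨
    ∃ i : Fin 4, z = i + 1 ∨ z = -(i + 1) := by
  by_cases h : z = 0 ∨ z < -4 ∨ 4 < z
  · exact Or.inl h
  · refine Or.inr ⟨⟨z.natAbs - 1, by omega⟩, ?_⟩
    dsimp only
    omega

lemma sum_abs_crossPolytopePoint {x : ℤ → ℝ} (hx : x ∈ realization crossPolytopeBoundary) :
    ∑ i : Fin 4, |crossPolytopePoint x i| = 1 := by
  obtain ⟨h0, -, hanti, hsum⟩ := mem_realization_crossPolytopeBoundary.1 hx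
  rw [← hsum]
  refine Finset.sum_congr rfl fun i _ => ?_
  rcases hanti (i + 1) with h | h <;> simp only [crossPolytopePoint, h]
  · simp [abs_of_nonneg (h0 _)]
  · simp [abs_of_nonneg (h0 _)]

lemma sum_abs_pos {y : EuclideanSpace ℝ (Fin 4)} (hy : y ≠ 0) : 0 < ∑ i : Fin 4, |y i| := by
  obtain ⟨i, hi⟩ : ∃ i, y i ≠ 0 := by
    by_contra! h
    exact hy (by ext i; simpa using h i)
  exact Finset.sum_pos' (fun i _ => abs_nonneg _) ⟨i, Finset.mem_univ i, abs_pos.2 hi⟩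

lemma crossPolytopePoint_ne_zero {x : ℤ → ℝ} (hx : x ∈ realization crossPolytopeBoundary) :
    crossPolytopePoint x ≠ 0 := fun h => by
  have := sum_abs_crossPolytopePoint hx
  simp [h] at this

lemma crossPolytopeCoord_smul {c : ℝ} (hc : 0 < c) (y : EuclideanSpace ℝ (Fin 4)) :
    crossPolytopeCoord (c • y) = crossPolytopeCoord y := by
  have hm : ∀ a : ℝ, max (c * a) 0 = c * max a 0 := fun a => by
    rw [mul_max_of_nonneg _ _ hc.le, mul_zero]
  have hL : ∑ i : Fin 4, |(c • y) i| = c * ∑ i : Fin 4, |y i| := by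
    simp [Finset.mul_sum, abs_mul, abs_of_pos hc]
  ext z
  rcases int_trichotomy z with h | ⟨i, rfl | rfl⟩
  · rw [crossPolytopeCoord_zero _ h, crossPolytopeCoord_zero _ h]
  · rw [crossPolytopeCoord_pos, crossPolytopeCoord_pos, hL, PiLp.smul_apply, smul_eq_mul, hm,
      mul_div_mul_left _ _ hc.ne']
  · rw [crossPolytopeCoord_neg, crossPolytopeCoord_neg, hL, PiLp.smul_apply, smul_eq_mul,
      ← mul_neg, hm, mul_div_mul_left _ _ hc.ne']

lemma crossPolytopeCoord_point {x : ℤ → ℝ} (hx : x ∈ realization crossPolytopeBoundary) :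
    crossPolytopeCoord (crossPolytopePoint x) = x := by
  obtain ⟨h0, hout, hanti, -⟩ := mem_realization_crossPolytopeBoundary.1 hx
  ext z
  rcases int_trichotomy z with h | ⟨i, rfl | rfl⟩
  · rw [crossPolytopeCoord_zero _ h, hout z h]
  · rw [crossPolytopeCoord_pos, sum_abs_crossPolytopePoint hx, div_one]
    rcases hanti (i + 1) with h | h <;> simp only [crossPolytopePoint, h]
    · simpa using h0 _
    · simpa using h0 _
  · rw [crossPolytopeCoord_neg, sum_abs_crossPolytopePoint hx, div_one]
    rcases hanti (i + 1) with h | h <;> simp only [crossPolytopePoint, h]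
    · simpa using h0 _
    · simpa using h0 _

lemma crossPolytopePoint_coord (y : EuclideanSpace ℝ (Fin 4)) :
    crossPolytopePoint (crossPolytopeCoord y) = (∑ i : Fin 4, |y i|)⁻¹ • y := by
  ext i
  simp only [crossPolytopePoint, crossPolytopeCoord_pos, crossPolytopeCoord_neg, PiLp.smul_apply,
    smul_eq_mul]
  rw [← sub_div, div_eq_inv_mul]
  congr 1
  rcases le_total 0 (y i) with h | h
  · rw [max_eq_left h, max_eq_right (by linarith), sub_zero]
  · rw [max_eq_right h, max_eq_left (by linarith), zero_sub, neg_neg]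

lemma crossPolytopeCoord_mem {y : EuclideanSpace ℝ (Fin 4)} (hy : y ≠ 0) :
    crossPolytopeCoord y ∈ realization crossPolytopeBoundary := by
  have hL := sum_abs_pos hy
  refine mem_realization_crossPolytopeBoundary.2 ⟨fun z => ?_, fun z hz =>
    crossPolytopeCoord_zero y hz, fun z => ?_, ?_⟩
  · rcases int_trichotomy z with h | ⟨i, rfl | rfl⟩
    · rw [crossPolytopeCoord_zero _ h]
    · rw [crossPolytopeCoord_pos]
      positivity
    · rw [crossPolytopeCoord_neg]
      positivity
  · have key : ∀ i : Fin 4, crossPolytopeCoord y (i + 1) = 0 ∨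
        crossPolytopeCoord y (-(i + 1)) = 0 := fun i => by
      rw [crossPolytopeCoord_pos, crossPolytopeCoord_neg]
      rcases le_total 0 (y i) with h | h
      · right; rw [max_eq_right (by linarith), zero_div]
      · left; rw [max_eq_right h, zero_div]
    rcases int_trichotomy z with h | ⟨i, rfl | rfl⟩
    · exact Or.inl (crossPolytopeCoord_zero _ h)
    · exact key i
    · rw [neg_neg]
      exact (key i).symm
  · simp only [crossPolytopeCoord_pos, crossPolytopeCoord_neg, ← add_div, ← Finset.sum_div]
    rw [div_eq_one_iff_eq hL.ne']
    refine Finset.sum_congr rfl fun i _ => ?_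
    rcases le_total 0 (y i) with h | h
    · rw [max_eq_left h, max_eq_right (by linarith), add_zero, abs_of_nonneg h]
    · rw [max_eq_right h, max_eq_left (by linarith), zero_add, abs_of_nonpos h]

lemma continuous_crossPolytopePoint : Continuous crossPolytopePoint := by
  unfold crossPolytopePoint
  fun_prop

lemma nonempty_homeomorph_crossPolytopeBoundary : Nonempty
    (realization crossPolytopeBoundary ≃ₜ Metric.sphere (0 : EuclideanSpace ℝ (Fin 4)) 1) := by
  have hne : ∀ y : Metric.sphere (0 : EuclideanSpace ℝ (Fin 4)) 1,
      (y : EuclideanSpace ℝ (Fin 4)) ≠ 0 := fun y => ne_zero_of_mem_unit_sphere y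
  exact ⟨{
    toFun := fun x => ⟨‖crossPolytopePoint x‖⁻¹ • crossPolytopePoint x, by
      simp [norm_smul, crossPolytopePoint_ne_zero x.2]⟩
    invFun := fun y => ⟨crossPolytopeCoord y, crossPolytopeCoord_mem (hne y)⟩
    left_inv := fun x => by
      refine Subtype.ext ?_
      dsimp only
      rw [crossPolytopeCoord_smul (inv_pos.2 (norm_pos_iff.2 (crossPolytopePoint_ne_zero x.2))),
        crossPolytopeCoord_point x.2]
    right_inv := fun y => by
      refine Subtype.ext ?_
      have hL := sum_abs_pos (hne y)
      dsimp only
      rw [crossPolytopePoint_coord, norm_smul, norm_eq_of_mem_sphere y, mul_one, norm_inv,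
        inv_inv, Real.norm_of_nonneg hL.le, smul_smul, mul_inv_cancel₀ hL.ne', one_smul]
    continuous_toFun := by
      have h := continuous_crossPolytopePoint.comp
        (continuous_subtype_val (p := (· ∈ realization crossPolytopeBoundary)))
      exact ((h.norm.inv₀ fun x => norm_ne_zero_iff.2 (crossPolytopePoint_ne_zero x.2)).smul
        h).subtype_mk _
    continuous_invFun := by
      refine Continuous.subtype_mk (continuous_pi fun z => ?_) _
      unfold crossPolytopeCoord
      refine Continuous.div ?_ (by fun_prop) fun y => (sum_abs_pos (hne y)).ne'
      refine Continuous.add ?_ ?_ <;> refine continuous_finsetSum _ fun i _ => ?_ <;>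
        split_ifs <;> fun_prop }⟩

lemma card_image_natAbs {s : Finset ℤ} (hs : s ∈ crossPolytopeBoundary) :
    (s.image Int.natAbs).card = s.card := by
  refine Finset.card_image_of_injOn fun x hx y hy hxy => ?_
  rcases Int.natAbs_eq_natAbs_iff.1 hxy with h | h
  · exact h
  · exact absurd (h ▸ hx) (hs y hy).2.2.2

lemma image_natAbs_subset {s : Finset ℤ} (hs : s ∈ crossPolytopeBoundary) :
    s.image Int.natAbs ⊆ Finset.Icc 1 4 := by
  intro k hk
  obtain ⟨x, hx, rfl⟩ := Finset.mem_image.1 hk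
  have := hs x hx
  rw [Finset.mem_Icc]
  omega

lemma isNeighborlySphere_crossPolytopeBoundary : IsNeighborlySphere 2 crossPolytopeBoundary where
  pseudomanifold :=
    { lower := fun s t hts hs x hx =>
        ⟨(hs x (hts hx)).1, (hs x (hts hx)).2.1, (hs x (hts hx)).2.2.1,
          fun h => (hs x (hts hx)).2.2.2 (hts h)⟩
      card_le := fun s hs => by
        rw [← card_image_natAbs hs]
        simpa using Finset.card_le_card (image_natAbs_subset hs)
      not_three := by
        intro t ht a b c ha hb hc hab hac hbc h1 h2 h3
        have key : ∀ x ∉ t, insert x t ∈ crossPolytopeBoundary →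
            x.natAbs ∈ Finset.Icc 1 4 \ t.image Int.natAbs := by
          intro x hx h
          refine Finset.mem_sdiff.2
            ⟨image_natAbs_subset h (Finset.mem_image_of_mem _ (Finset.mem_insert_self _ _)), ?_⟩
          intro hxt
          obtain ⟨y, hy, hyx⟩ := Finset.mem_image.1 hxt
          rcases Int.natAbs_eq_natAbs_iff.1 hyx with rfl | rfl
          · exact hx hy
          · exact (h x (Finset.mem_insert_self _ _)).2.2.2 (Finset.mem_insert_of_mem hy)
        have htK : t ∈ crossPolytopeBoundary := fun x hx => by
          have := h1 x (Finset.mem_insert_of_mem hx)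
          exact ⟨this.1, this.2.1, this.2.2.1,
            fun h => this.2.2.2 (Finset.mem_insert_of_mem h)⟩
        have hcard : (Finset.Icc 1 4 \ t.image Int.natAbs).card = 1 := by
          rw [Finset.card_sdiff_of_subset (image_natAbs_subset htK), card_image_natAbs htK, ht]
          rfl
        have hu := Finset.card_le_one.1 hcard.le
        have := hu _ (key a ha h1) _ (key b hb h2)
        have := hu _ (key a ha h1) _ (key c hc h3)
        omega }
  bounds := fun s hs x hx => by have := hs x hx; omega
  neg_notMem := fun s hs x hx => (hs x hx).2.2.2
  neg_mem := fun s hs x hx => by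
    have := hs (-x) (by simpa using hx)
    refine ⟨by omega, by omega, by omega, ?_⟩
    simpa using this.2.2.2
  edge := by
    intro x y hx hy hx1 hx2 hy1 hy2 hxy z hz
    simp only [Finset.mem_insert, Finset.mem_singleton] at hz ⊢
    omega
  tetrahedra_subset := by
    unfold tetrahedra PathEdge
    rintro T (⟨x, y, hxy, rfl⟩ | rfl | rfl) z hz <;>
      simp only [Finset.mem_insert, Finset.mem_singleton] at hz ⊢ <;> omega
  homeomorph := nonempty_homeomorph_crossPolytopeBoundary

lemma exists_isNeighborlySphere (k : ℕ) : ∃ K, IsNeighborlySphere (k + 2) K := by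
  induction k with
  | zero => exact ⟨_, by simpa using isNeighborlySphere_crossPolytopeBoundary⟩
  | succ k ih =>
    obtain ⟨K, hK⟩ := ih
    refine ⟨addAntipodalPair (k + 2) K, ?_⟩
    have := hK.succ (by omega)
    rwa [show (k : ℤ) + 2 + 1 = (k + 1 : ℕ) + 2 by push_cast; ring] at this

end CrossPolytope

/-! ### Embedding the spheres into Euclidean space -/

section Embedding

open Pointwise

/-- The vertex of the standard simplex in `ℝ²ⁿ⁺¹` with label `z ∈ {-n, …, n}`. -/
def labelVertex (n : ℕ) (z : ℤ) : Fin (2 * n + 1) → ℝ := fun i => if (i : ℤ) = z + n then 1 else 0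

lemma labelVertex_sub (n : ℕ) (i : Fin (2 * n + 1)) :
    labelVertex n (i - n) = Pi.single i 1 := by
  ext j
  simp [labelVertex, Pi.single_apply, Fin.ext_iff]

lemma exists_eq_sub {n : ℕ} {z : ℤ} (h1 : -n ≤ z) (h2 : z ≤ n) :
    ∃ i : Fin (2 * n + 1), z = i - n :=
  ⟨⟨(z + n).toNat, by omega⟩, by dsimp only; omega⟩

lemma injOn_labelVertex (n : ℕ) : InjOn (labelVertex n) (Icc (-n) n) := by
  intro x hx y hy hxy
  obtain ⟨i, rfl⟩ := exists_eq_sub hx.1 hx.2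
  obtain ⟨j, rfl⟩ := exists_eq_sub hy.1 hy.2
  rw [labelVertex_sub, labelVertex_sub] at hxy
  have := congrFun hxy i
  rw [Pi.single_eq_same, Pi.single_apply] at this
  by_cases h : i = j
  · rw [h]
  · simp [h] at this

lemma labelVertex_neg (n : ℕ) (z : ℤ) : (fun i => labelVertex n z i.rev) = labelVertex n (-z) := by
  ext i
  simp only [labelVertex, Fin.val_rev]
  congr 1
  rw [eq_iff_iff]
  omega

/-- The geometric simplicial complex in `ℝ²ⁿ⁺¹` whose faces are the nonempty faces of `K`, placed
on the vertices of the standard simplex. -/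
noncomputable def labelComplex (n : ℕ) (K : Set (Finset ℤ)) (hK : IsLowerSet K)
    (hb : ∀ s ∈ K, ∀ x ∈ s, -n ≤ x ∧ x ≤ n) :
    Geometry.SimplicialComplex ℝ (Fin (2 * n + 1) → ℝ) :=
  Geometry.SimplicialComplex.ofAffineIndependent
    { faces := {t | ∃ s ∈ K, s.Nonempty ∧ s.image (labelVertex n) = t}
      isRelLowerSet_faces := by
        rintro _ ⟨s, hs, hne, rfl⟩
        refine ⟨hne.image _, fun t ht htne => ?_⟩
        obtain ⟨u, hu, rfl⟩ := Finset.subset_image_iff.1 ht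
        exact ⟨u, hK hu hs, Finset.image_nonempty.1 htne, rfl⟩ }
    (by
      refine (Pi.basisFun ℝ (Fin (2 * n + 1))).linearIndependent.affineIndependent.range.mono
        fun v hv => ?_
      simp only [mem_iUnion] at hv
      obtain ⟨_, ⟨s, hs, -, rfl⟩, hv⟩ := hv
      obtain ⟨z, hz, rfl⟩ := Finset.mem_image.1 hv
      obtain ⟨i, rfl⟩ := exists_eq_sub (hb s hs z hz).1 (hb s hs z hz).2
      exact ⟨i, by rw [labelVertex_sub, Pi.basisFun_apply]⟩)

section Homeomorph

variable {n : ℕ} {K : Set (Finset ℤ)} (hK : IsLowerSet K)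
  (hb : ∀ s ∈ K, ∀ x ∈ s, -n ≤ x ∧ x ≤ n)

lemma mem_faces_labelComplex {t : Finset (Fin (2 * n + 1) → ℝ)} :
    t ∈ (labelComplex n K hK hb).faces ↔ ∃ s ∈ K, s.Nonempty ∧ s.image (labelVertex n) = t :=
  Iff.rfl

lemma mem_space_labelComplex_of_mem_realization {x : ℤ → ℝ} (hx : x ∈ realization K) :
    (fun i : Fin (2 * n + 1) => x (i - n)) ∈ (labelComplex n K hK hb).space := by
  obtain ⟨s, hs, hpos, hzero, hsum⟩ := hx
  have hne : s.Nonempty := by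
    rw [Finset.nonempty_iff_ne_empty]
    rintro rfl
    simp at hsum
  have hx' : (fun i : Fin (2 * n + 1) => x (i - n)) = ∑ z ∈ s, x z • labelVertex n z := by
    ext i
    have h : ∀ z : ℤ, ((i : ℤ) = z + n) ↔ (i : ℤ) - n = z := fun z => by omega
    simp only [Finset.sum_apply, Pi.smul_apply, labelVertex, smul_eq_mul, mul_ite, mul_one,
      mul_zero, h, Finset.sum_ite_eq]
    split_ifs with hi
    · rfl
    · exact hzero _ hi
  refine (labelComplex n K hK hb).mem_space_iff.2 ⟨_, ⟨s, hs, hne, rfl⟩, ?_⟩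
  rw [hx']
  exact (convex_convexHull ℝ _).sum_mem (fun z hz => (hpos z hz).le) hsum fun z hz =>
    subset_convexHull ℝ _ (Finset.mem_coe.2 (Finset.mem_image_of_mem _ hz))

/-- Reindexing of coordinates by the labels in `ℤ`, extended by zero. -/
def labelCoord (n : ℕ) (y : Fin (2 * n + 1) → ℝ) (z : ℤ) : ℝ :=
  ∑ i : Fin (2 * n + 1), if (i : ℤ) = z + n then y i else 0

lemma labelCoord_sub (y : Fin (2 * n + 1) → ℝ) (i : Fin (2 * n + 1)) :
    labelCoord n y (i - n) = y i := by
  have h : ∀ j : Fin (2 * n + 1), ((j : ℤ) = (i : ℤ) - n + n) ↔ i = j := fun j => by omega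
  simp only [labelCoord, h, Finset.sum_ite_eq, Finset.mem_univ, if_true]

lemma labelCoord_eq_zero (y : Fin (2 * n + 1) → ℝ) {z : ℤ} (hz : ¬(-n ≤ z ∧ z ≤ n)) :
    labelCoord n y z = 0 :=
  Finset.sum_eq_zero fun i _ => if_neg (by omega)

lemma convexHull_labelVertex_subset {s : Finset ℤ} (hs : ∀ x ∈ s, -n ≤ x ∧ x ≤ n) :
    convexHull ℝ (s.image (labelVertex n) : Set (Fin (2 * n + 1) → ℝ)) ⊆
      {y | (∀ i, 0 ≤ y i) ∧ (∀ i : Fin (2 * n + 1), (i : ℤ) - n ∉ s → y i = 0) ∧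
        ∑ i, y i = 1} := by
  refine convexHull_min (fun v hv => ?_) ?_
  · obtain ⟨z, hz, rfl⟩ := Finset.mem_image.1 (Finset.mem_coe.1 hv)
    obtain ⟨i, rfl⟩ := exists_eq_sub (hs z hz).1 (hs z hz).2
    rw [labelVertex_sub]
    refine ⟨fun j => ?_, fun j hj => ?_, by simp⟩
    · rw [Pi.single_apply]
      split_ifs <;> norm_num
    · exact Pi.single_eq_of_ne (fun h => hj (by rwa [h])) _
  · rintro y ⟨hy0, hyz, hy1⟩ w ⟨hw0, hwz, hw1⟩ a b ha hb hab
    refine ⟨fun i => ?_, fun i hi => ?_, ?_⟩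
    · exact add_nonneg (mul_nonneg ha (hy0 i)) (mul_nonneg hb (hw0 i))
    · simp [hyz i hi, hwz i hi]
    · simp [Finset.sum_add_distrib, ← Finset.mul_sum, hy1, hw1, hab]

include hK hb in
lemma labelCoord_mem_realization {y : Fin (2 * n + 1) → ℝ}
    (hy : y ∈ (labelComplex n K hK hb).space) : labelCoord n y ∈ realization K := by
  obtain ⟨_, ⟨s, hs, -, rfl⟩, hy⟩ := (labelComplex n K hK hb).mem_space_iff.1 hy
  obtain ⟨h0, hz, h1⟩ := convexHull_labelVertex_subset (hb s hs) hy
  have hnonneg : ∀ z, 0 ≤ labelCoord n y z := fun z =>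
    Finset.sum_nonneg fun i _ => by split_ifs <;> [exact h0 i; rfl]
  refine ⟨s.filter fun z => 0 < labelCoord n y z, hK (Finset.filter_subset _ _) hs,
    fun z hz => (Finset.mem_filter.1 hz).2, fun z hzs => ?_, ?_⟩
  · by_contra h
    refine hzs (Finset.mem_filter.2 ⟨?_, lt_of_le_of_ne (hnonneg z) (Ne.symm h)⟩)
    by_contra hzs
    by_cases hzn : -n ≤ z ∧ z ≤ n
    · obtain ⟨i, rfl⟩ := exists_eq_sub hzn.1 hzn.2
      exact h ((labelCoord_sub y i).trans (hz i hzs))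
    · exact h (labelCoord_eq_zero y hzn)
  · rw [Finset.sum_filter_of_ne fun z _ h => lt_of_le_of_ne (hnonneg z) (Ne.symm h), ← h1]
    unfold labelCoord
    rw [Finset.sum_comm]
    refine Finset.sum_congr rfl fun i _ => ?_
    have h : ∀ z : ℤ, ((i : ℤ) = z + n) ↔ (i : ℤ) - n = z := fun z => by omega
    simp only [h, Finset.sum_ite_eq]
    split_ifs with hi
    · rfl
    · exact (hz i hi).symm

/-- The underlying space of the complex is the realization of `K`. -/
def realizationHomeomorph : realization K ≃ₜ (labelComplex n K hK hb).space where
  toFun x := ⟨fun i => x.1 (i - n), mem_space_labelComplex_of_mem_realization hK hb x.2⟩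
  invFun y := ⟨labelCoord n y.1, labelCoord_mem_realization hK hb y.2⟩
  left_inv x := by
    ext z
    dsimp only
    by_cases hz : -n ≤ z ∧ z ≤ n
    · obtain ⟨i, rfl⟩ := exists_eq_sub hz.1 hz.2
      rw [labelCoord_sub]
    · rw [labelCoord_eq_zero _ hz]
      obtain ⟨s, hs, -, hzero, -⟩ := x.2
      exact (hzero z fun h => hz (hb s hs z h)).symm
  right_inv y := by
    ext i
    exact labelCoord_sub _ i
  continuous_toFun := by
    refine Continuous.subtype_mk (continuous_pi fun i => ?_) _
    exact (continuous_apply _).comp continuous_subtype_val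
  continuous_invFun := by
    refine Continuous.subtype_mk (continuous_pi fun z => ?_) _
    refine continuous_finsetSum _ fun i _ => ?_
    split_ifs
    · exact (continuous_apply i).comp continuous_subtype_val
    · exact continuous_const

end Homeomorph

/-- The labels `±1, …, ±n`. -/
noncomputable def labels (n : ℕ) : Finset ℤ := (Finset.Icc (-n : ℤ) n).erase 0

lemma mem_labels {n : ℕ} {z : ℤ} : z ∈ labels n ↔ z ≠ 0 ∧ -n ≤ z ∧ z ≤ n := by
  simp [labels]

lemma card_labels (n : ℕ) : (labels n).card = 2 * n := by
  rw [labels, Finset.card_erase_of_mem (by simp), Int.card_Icc]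
  omega

/-- The pairs of labels that are not antipodal. -/
noncomputable def labelPairs (n : ℕ) : Finset (Finset ℤ) :=
  (labels n).powersetCard 2 \ (Finset.Icc 1 (n : ℤ)).image fun k => {k, -k}

lemma card_labelPairs (n : ℕ) : (labelPairs n).card = (2 * n).choose 2 - n := by
  rw [labelPairs, Finset.card_sdiff_of_subset, Finset.card_powersetCard, card_labels,
    Finset.card_image_of_injOn, Int.card_Icc]
  · simp
  · intro x hx y hy hxy
    rw [Finset.coe_Icc, mem_Icc] at hx hy
    dsimp only at hxy
    have : x ∈ ({y, -y} : Finset ℤ) := hxy ▸ Finset.mem_insert_self x {-x}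
    rw [Finset.mem_insert, Finset.mem_singleton] at this
    omega
  · intro s hs
    obtain ⟨k, hk, rfl⟩ := Finset.mem_image.1 hs
    rw [Finset.mem_Icc] at hk
    refine Finset.mem_powersetCard.2 ⟨fun z hz => mem_labels.2 ?_, Finset.card_pair (by omega)⟩
    rw [Finset.mem_insert, Finset.mem_singleton] at hz
    omega

lemma mem_labelPairs {n : ℕ} {s : Finset ℤ} : s ∈ labelPairs n ↔
    ∃ x ∈ labels n, ∃ y ∈ labels n, x ≠ y ∧ x ≠ -y ∧ s = {x, y} := by
  rw [labelPairs, Finset.mem_sdiff, Finset.mem_powersetCard]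
  constructor
  · rintro ⟨⟨hs, hcard⟩, h⟩
    obtain ⟨x, y, hxy, rfl⟩ := Finset.card_eq_two.1 hcard
    have hx := hs (Finset.mem_insert_self _ _)
    have hy := hs (Finset.mem_insert_of_mem (Finset.mem_singleton_self _))
    refine ⟨x, hx, y, hy, hxy, ?_, rfl⟩
    rintro rfl
    rw [mem_labels] at hx hy
    refine h (Finset.mem_image.2 ?_)
    by_cases hpos : 0 < y
    · exact ⟨y, Finset.mem_Icc.2 (by omega), Finset.pair_comm _ _⟩
    · exact ⟨-y, Finset.mem_Icc.2 (by omega), by rw [neg_neg]⟩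
  · rintro ⟨x, hx, y, hy, hxy, hxy', rfl⟩
    refine ⟨⟨?_, Finset.card_pair hxy⟩, fun h => ?_⟩
    · rw [Finset.insert_subset_iff, Finset.singleton_subset_iff]
      exact ⟨hx, hy⟩
    · obtain ⟨k, -, hk⟩ := Finset.mem_image.1 h
      have h1 : x ∈ ({k, -k} : Finset ℤ) := hk ▸ Finset.mem_insert_self _ _
      have h2 : y ∈ ({k, -k} : Finset ℤ) :=
        hk ▸ Finset.mem_insert_of_mem (Finset.mem_singleton_self _)
      rw [Finset.mem_insert, Finset.mem_singleton] at h1 h2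
      omega

section Sphere

variable {n : ℕ} {K : Set (Finset ℤ)} (hK : IsLowerSet K)
  (hb : ∀ s ∈ K, ∀ x ∈ s, -n ≤ x ∧ x ≤ n)

lemma vertices_labelComplex (h0 : ∀ s ∈ K, 0 ∉ s) (h1 : ∀ z ∈ labels n, {z} ∈ K) :
    (labelComplex n K hK hb).vertices = labelVertex n '' labels n := by
  ext v
  rw [Geometry.SimplicialComplex.mem_vertices, mem_faces_labelComplex]
  constructor
  · rintro ⟨s, hs, -, hsv⟩
    have hv : v ∈ s.image (labelVertex n) := hsv ▸ Finset.mem_singleton_self v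
    obtain ⟨z, hz, rfl⟩ := Finset.mem_image.1 hv
    exact ⟨z, mem_labels.2 ⟨fun h => h0 s hs (h ▸ hz), hb s hs z hz⟩, rfl⟩
  · rintro ⟨z, hz, rfl⟩
    exact ⟨{z}, h1 z hz, Finset.singleton_nonempty z, Finset.image_singleton _ _⟩

lemma image_rev_image_labelVertex (s : Finset ℤ) :
    (s.image (labelVertex n)).image (fun y i => y i.rev) = (-s).image (labelVertex n) := by
  rw [Finset.image_image, ← Finset.image_neg_eq_neg, Finset.image_image]
  exact Finset.image_congr fun z _ => labelVertex_neg n z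

lemma edges_labelComplex
    (h2 : ∀ s, s ∈ K ∧ s.card = 2 ↔ s ∈ labelPairs n) :
    {t ∈ (labelComplex n K hK hb).faces | t.card = 2} =
      Finset.image (labelVertex n) '' labelPairs n := by
  have hcard : ∀ s ∈ K, (s.image (labelVertex n)).card = s.card := fun s hs =>
    Finset.card_image_of_injOn ((injOn_labelVertex n).mono fun x hx => hb s hs x hx)
  ext t
  constructor
  · rintro ⟨⟨s, hs, -, rfl⟩, ht⟩
    exact ⟨s, (h2 s).1 ⟨hs, hcard s hs ▸ ht⟩, rfl⟩
  · rintro ⟨s, hs, rfl⟩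
    obtain ⟨hsK, hs2⟩ := (h2 s).2 hs
    exact ⟨⟨s, hsK, Finset.card_pos.1 (by omega), rfl⟩, (hcard s hsK).trans hs2⟩

lemma injOn_image_labelVertex :
    InjOn (Finset.image (labelVertex n)) {s : Finset ℤ | (s : Set ℤ) ⊆ Icc (-n) n} := by
  intro s hs t ht hst
  have h := congrArg SetLike.coe hst
  rw [Finset.coe_image, Finset.coe_image] at h
  exact Finset.coe_injective (((injOn_labelVertex n).image_eq_image_iff hs ht).1 h)

lemma ncard_edges_labelComplex
    (h2 : ∀ s, s ∈ K ∧ s.card = 2 ↔ s ∈ labelPairs n) :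
    {t ∈ (labelComplex n K hK hb).faces | t.card = 2}.ncard = (2 * n).choose 2 - n := by
  rw [edges_labelComplex hK hb h2, InjOn.ncard_image, ncard_coe_finset, card_labelPairs]
  exact injOn_image_labelVertex.mono fun s hs x hx => hb s ((h2 s).2 hs).1 x hx

lemma ncard_vertices_labelComplex (h0 : ∀ s ∈ K, 0 ∉ s) (h1 : ∀ z ∈ labels n, {z} ∈ K) :
    (labelComplex n K hK hb).vertices.ncard = 2 * n := by
  rw [vertices_labelComplex hK hb h0 h1, InjOn.ncard_image, ncard_coe_finset, card_labels]
  exact (injOn_labelVertex n).mono fun x hx => (mem_labels.1 hx).2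

lemma isCSComplex_labelComplex (h0 : ∀ s ∈ K, 0 ∉ s) (h1 : ∀ z ∈ labels n, {z} ∈ K)
    (hneg : ∀ s ∈ K, -s ∈ K) (hanti : ∀ s ∈ K, ∀ x ∈ s, -x ∉ s) :
    IsCSComplex (labelComplex n K hK hb) fun y i => y i.rev := by
  refine ⟨?_, ?_, ?_, ?_⟩
  · rw [vertices_labelComplex hK hb h0 h1]
    rintro _ ⟨z, hz, rfl⟩
    refine ⟨-z, ?_, (labelVertex_neg _ z).symm⟩
    rw [Finset.mem_coe, mem_labels] at hz ⊢
    omega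
  · intro v _
    simp only [Fin.rev_rev]
  · rintro _ ⟨s, hs, hne, rfl⟩
    exact ⟨-s, hneg s hs, hne.neg, (image_rev_image_labelVertex s).symm⟩
  · rintro _ ⟨s, hs, ⟨x, hx⟩, rfl⟩ h
    rw [image_rev_image_labelVertex] at h
    have := injOn_image_labelVertex (fun x hx => hb _ (hneg s hs) x hx)
      (fun x hx => hb s hs x hx) h
    exact hanti s hs x hx (this ▸ Finset.neg_mem_neg hx)

end Sphere

end Embedding

theorem stmt12 (N : ℕ) (hN : 8 ≤ N) (heven : Even N) :
    ∃ (M : ℕ) (K : Geometry.SimplicialComplex ℝ (Fin M → ℝ))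
      (φ : (Fin M → ℝ) → (Fin M → ℝ)),
      IsCSComplex K φ ∧
      K.vertices.ncard = N ∧
      Nonempty (K.space ≃ₜ Metric.sphere (0 : EuclideanSpace ℝ (Fin 4)) 1) ∧
      (∀ u ∈ K.vertices, ∀ v ∈ K.vertices, u ≠ v → v ≠ φ u →
        ({u, v} : Finset (Fin M → ℝ)) ∈ K.faces) ∧
      {s ∈ K.faces | s.card = 2}.ncard = N.choose 2 - N / 2 := by
  obtain ⟨n, rfl⟩ := heven.two_dvd
  obtain ⟨k, rfl⟩ : ∃ k, n = k + 4 := ⟨n - 4, by omega⟩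
  obtain ⟨K, hS⟩ := exists_isNeighborlySphere k
  have hK : IsLowerSet K := hS.pseudomanifold.lower
  have hb : ∀ s ∈ K, ∀ x ∈ s, -((k + 4 : ℕ) : ℤ) ≤ x ∧ x ≤ (k + 4 : ℕ) := fun s hs x hx => by
    have := hS.bounds s hs x hx
    omega
  have h0 : ∀ s ∈ K, 0 ∉ s := fun s hs h => (hS.bounds s hs 0 h).1 rfl
  have hedge : ∀ x ∈ labels (k + 4), ∀ y ∈ labels (k + 4), x ≠ -y → {x, y} ∈ K := by
    intro x hx y hy hxy
    rw [mem_labels] at hx hy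
    exact hS.edge x y hx.1 hy.1 (by omega) (by omega) (by omega) (by omega) hxy
  have h1 : ∀ z ∈ labels (k + 4), {z} ∈ K := fun z hz => by
    have := hedge z hz z hz (by have := (mem_labels.1 hz).1; omega)
    rwa [Finset.pair_eq_singleton] at this
  have h2 : ∀ s, s ∈ K ∧ s.card = 2 ↔ s ∈ labelPairs (k + 4) := by
    intro s
    rw [mem_labelPairs]
    constructor
    · rintro ⟨hs, hcard⟩
      obtain ⟨x, y, hxy, rfl⟩ := Finset.card_eq_two.1 hcard
      have hx : x ∈ ({x, y} : Finset ℤ) := Finset.mem_insert_self _ _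
      have hy : y ∈ ({x, y} : Finset ℤ) :=
        Finset.mem_insert_of_mem (Finset.mem_singleton_self _)
      exact ⟨x, mem_labels.2 ⟨(hS.bounds _ hs x hx).1, hb _ hs x hx⟩, y,
        mem_labels.2 ⟨(hS.bounds _ hs y hy).1, hb _ hs y hy⟩, hxy,
        fun h => hS.neg_notMem _ hs y hy (h ▸ hx), rfl⟩
    · rintro ⟨x, hx, y, hy, hxy, hxy', rfl⟩
      exact ⟨hedge x hx y hy hxy', Finset.card_pair hxy⟩
  have hV := vertices_labelComplex hK hb h0 h1
  refine ⟨_, labelComplex (k + 4) K hK hb, fun y i => y i.rev,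
    isCSComplex_labelComplex hK hb h0 h1 hS.neg_mem hS.neg_notMem,
    ncard_vertices_labelComplex hK hb h0 h1,
    hS.homeomorph.map (realizationHomeomorph hK hb).symm.trans, ?_, ?_⟩
  · rw [hV]
    rintro _ ⟨x, hx, rfl⟩ _ ⟨y, hy, rfl⟩ - hxy
    refine ⟨{x, y}, hedge x hx y hy ?_, Finset.insert_nonempty _ _, ?_⟩
    · rintro rfl
      exact hxy ((labelVertex_neg _ _).trans (by rw [neg_neg])).symm
    · rw [Finset.image_insert, Finset.image_singleton]
  · rw [ncard_edges_labelComplex hK hb h2, Nat.mul_div_cancel_left _ two_pos]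
end
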